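/- arXiv:0712.3238 — 2 statements merged into one kernel-verified Lean document; each statement's English description precedes it below -/
import Mathlib

section
/- Let κ be a real number and x₀ > 0 a real number. There exists a unique entire function F : ℂ → ℂ such that F(μ) = W_{κ,μ}(x₀) for every complex μ with 2μ not an integer; moreover this F satisfies the functional equation F(−μ) = F(μ) for all complex μ. -/
/-- The Whittaker M-function `M_{κ,μ}(x)` for real `x > 0`, defined by its series. -/
noncomputable def whittakerM (κ μ : ℂ) (x : ℝ) : ℂ :=
  Complex.exp (-(x:ℂ)/2) * Complex.exp ((1/2 + μ) * (Real.log x : ℂ)) *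
    ∑' j : ℕ, (Polynomial.eval (1/2 - κ + μ) (ascPochhammer ℂ j)) /
      ((Polynomial.eval (2*μ + 1) (ascPochhammer ℂ j)) * (Nat.factorial j : ℂ)) * (x:ℂ)^j

/-- The Whittaker W-function `W_{κ,μ}(x)` for real `x > 0` and `2μ` not an integer. -/
noncomputable def whittakerW (κ μ : ℂ) (x : ℝ) : ℂ :=
  Complex.Gamma (-(2*μ)) / Complex.Gamma (1/2 - κ - μ) * whittakerM κ μ x +
  Complex.Gamma (2*μ) / Complex.Gamma (1/2 - κ + μ) * whittakerM κ (-μ) x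

open Polynomial in
lemma wh_gamma_inv (s : ℂ) (n : ℕ) :
    (Complex.Gamma s)⁻¹ = (ascPochhammer ℂ n).eval s * (Complex.Gamma (s + n))⁻¹ := by
  induction n with
  | zero => simp
  | succ n ih =>
    rw [ih, ascPochhammer_succ_eval, Complex.one_div_Gamma_eq_self_mul_one_div_Gamma_add_one (s + n)]
    push_cast
    rw [← add_assoc]
    ring

noncomputable def whT (a : ℂ) (x : ℝ) (j : ℕ) (μ : ℂ) : ℂ :=
  (ascPochhammer ℂ j).eval (a + μ) * (Complex.Gamma (2 * μ + 1 + j))⁻¹ / (Nat.factorial j : ℂ) *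
    (x : ℂ) ^ j

lemma whT_diff (a : ℂ) (x : ℝ) (j : ℕ) : Differentiable ℂ (whT a x j) := by
  have h1 : Differentiable ℂ (fun μ : ℂ => (ascPochhammer ℂ j).eval (a + μ)) :=
    (Polynomial.differentiable (ascPochhammer ℂ j)).comp
      (by fun_prop : Differentiable ℂ (fun μ : ℂ => a + μ))
  have h2 : Differentiable ℂ (fun μ : ℂ => (Complex.Gamma (2 * μ + 1 + j))⁻¹) :=
    Complex.differentiable_one_div_Gamma.comp
      (by fun_prop : Differentiable ℂ (fun μ : ℂ => 2 * μ + 1 + j))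
  unfold whT
  exact ((h1.mul h2).div_const _).mul_const _

lemma whT_rec (a : ℂ) (x : ℝ) (j : ℕ) (μ : ℂ) :
    whT a x (j + 1) μ * ((2 * μ + 1 + j) * (j + 1)) = (a + μ + j) * x * whT a x j μ := by
  unfold whT
  rw [ascPochhammer_succ_eval,
    Complex.one_div_Gamma_eq_self_mul_one_div_Gamma_add_one (2 * μ + 1 + j), Nat.factorial_succ]
  have h : (Nat.factorial j : ℂ) ≠ 0 := by exact_mod_cast Nat.factorial_ne_zero j
  have h2 : (j : ℂ) + 1 ≠ 0 := by exact_mod_cast Nat.succ_ne_zero j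
  push_cast
  rw [← add_assoc, pow_succ]
  field_simp

lemma whT_bound (a : ℂ) (x : ℝ) (R : ℝ) (hR : 0 < R) :
    ∃ u : ℕ → ℝ, Summable u ∧ ∀ j, ∀ μ ∈ Metric.ball (0 : ℂ) R, ‖whT a x j μ‖ ≤ u j := by
  have hC : ∀ j, ∃ C, ∀ μ ∈ Metric.closedBall (0 : ℂ) R, ‖whT a x j μ‖ ≤ C := fun j =>
    (isCompact_closedBall (0 : ℂ) R).exists_bound_of_continuousOn (whT_diff a x j).continuous.continuousOn
  choose C hC using hC
  obtain ⟨N, hN⟩ := exists_nat_gt (4 * R + ‖a‖ + R + 8 * |x|)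
  have step : ∀ j ≥ N, ∀ μ ∈ Metric.ball (0 : ℂ) R,
      ‖whT a x (j + 1) μ‖ ≤ 1 / 2 * ‖whT a x j μ‖ := by
    intro j hj μ hμ
    have hμ' : ‖μ‖ < R := by simpa using hμ
    have hj' : (N : ℝ) ≤ j := by exact_mod_cast hj
    have e := congrArg norm (whT_rec a x j μ)
    rw [norm_mul, norm_mul, norm_mul, norm_mul, Complex.norm_real, Real.norm_eq_abs] at e
    have n1 : ‖(j : ℂ) + 1‖ = j + 1 := by
      have : (j : ℂ) + 1 = ((j + 1 : ℕ) : ℂ) := by push_cast; rfl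
      rw [this, Complex.norm_natCast]; push_cast; rfl
    have n2 : ‖(j : ℂ)‖ = j := Complex.norm_natCast j
    have l1 : (j : ℝ) + 1 - 2 * R ≤ ‖2 * μ + 1 + j‖ := by
      have t := norm_sub_le (2 * μ + 1 + j) (2 * μ)
      have : 2 * μ + 1 + j - 2 * μ = (j : ℂ) + 1 := by ring
      rw [this, n1, norm_mul] at t
      simp only [Complex.norm_ofNat] at t
      linarith
    have l2 : ‖a + μ + j‖ ≤ ‖a‖ + R + j := by
      have t := norm_add₃_le (a := a) (b := μ) (c := (j : ℂ))
      rw [n2] at t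
      linarith
    rw [n1] at e
    set p := ‖whT a x (j + 1) μ‖
    set q := ‖whT a x j μ‖
    have hp : 0 ≤ p := norm_nonneg _
    have hq : 0 ≤ q := norm_nonneg _
    have hx := abs_nonneg x
    have ha := norm_nonneg a
    have hjx : 8 * |x| ≤ j := by linarith
    have d1 : ((j : ℝ) + 1) / 2 ≤ j + 1 - 2 * R := by linarith
    have A : p * (((j : ℝ) + 1) / 2 * (j + 1)) ≤ (2 * j) * (j / 8) * q := by
      calc p * (((j : ℝ) + 1) / 2 * (j + 1)) ≤ p * (‖2 * μ + 1 + j‖ * (j + 1)) := by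
            gcongr; linarith
        _ = _ := e
        _ ≤ (2 * j) * (j / 8) * q := by
            gcongr <;> linarith
    have hj0 : (0:ℝ) ≤ j := Nat.cast_nonneg j
    have B : p * (((j : ℝ) + 1) * (j + 1)) ≤ (1 / 2 * q) * ((j + 1) * (j + 1)) := by
      nlinarith [mul_nonneg hq hj0]
    exact le_of_mul_le_mul_right B (by positivity)
  refine ⟨fun j => if j < N then C j else C N * (1 / 2) ^ (j - N), ?_, ?_⟩
  · rw [← summable_nat_add_iff N]
    have : (fun k : ℕ => if k + N < N then C (k + N) else C N * (1 / 2 : ℝ) ^ (k + N - N)) =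
        fun k => C N * (1 / 2 : ℝ) ^ k := by
      funext k; simp
    rw [this]
    exact summable_geometric_two.mul_left _
  · intro j μ hμ
    by_cases h : j < N
    · simp only [h, if_true]
      exact hC j μ (Metric.ball_subset_closedBall hμ)
    · simp only [h, if_false]
      obtain ⟨k, rfl⟩ := Nat.exists_eq_add_of_le (not_lt.mp h)
      rw [Nat.add_sub_cancel_left]
      clear h
      induction k with
      | zero => simpa using hC N μ (Metric.ball_subset_closedBall hμ)
      | succ k ih =>
        have := step (N + k) (by omega) μ hμ
        rw [← add_assoc, pow_succ]
        linarith

lemma whT_summable (a : ℂ) (x : ℝ) (μ : ℂ) : Summable (fun j => whT a x j μ) := by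
  obtain ⟨u, hu, hb⟩ := whT_bound a x (‖μ‖ + 1) (by positivity)
  exact Summable.of_norm_bounded hu (fun j => hb j μ (by simp))

noncomputable def whS (a : ℂ) (x : ℝ) (μ : ℂ) : ℂ := ∑' j, whT a x j μ

lemma whS_diff (a : ℂ) (x : ℝ) : Differentiable ℂ (whS a x) := by
  intro μ
  obtain ⟨u, hu, hb⟩ := whT_bound a x (‖μ‖ + 1) (by positivity)
  have := Complex.differentiableOn_tsum_of_summable_norm hu
    (fun j => (whT_diff a x j).differentiableOn) Metric.isOpen_ball hb
  exact this.differentiableAt (Metric.isOpen_ball.mem_nhds (by simp))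

/-- regularised M -/
noncomputable def whR (a : ℂ) (x : ℝ) (μ : ℂ) : ℂ :=
  Complex.exp (-(x:ℂ)/2) * Complex.exp ((1/2 + μ) * (Real.log x : ℂ)) * whS a x μ

lemma whR_diff (a : ℂ) (x : ℝ) : Differentiable ℂ (whR a x) := by
  unfold whR
  have := whS_diff a x
  fun_prop

lemma whM_eq (κ μ : ℂ) (x : ℝ) (h : ∀ n : ℤ, 2*μ ≠ (n:ℂ)) :
    whittakerM κ μ x = Complex.Gamma (2 * μ + 1) * whR (1/2 - κ) x μ := by
  have hG : Complex.Gamma (2 * μ + 1) ≠ 0 := by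
    refine Complex.Gamma_ne_zero fun m hm => h (-m - 1) ?_
    push_cast
    linear_combination hm
  unfold whittakerM whR whS
  rw [mul_left_comm (Complex.Gamma (2 * μ + 1))]
  congr 1
  rw [← tsum_mul_left]
  refine tsum_congr fun j => ?_
  unfold whT
  have e := wh_gamma_inv (2 * μ + 1) j
  have hP : (ascPochhammer ℂ j).eval (2 * μ + 1) ≠ 0 := by
    intro h0
    rw [h0, zero_mul] at e
    exact hG (inv_eq_zero.mp e)
  have e2 : (Complex.Gamma (2 * μ + 1 + j))⁻¹ =
      (Complex.Gamma (2 * μ + 1))⁻¹ / (ascPochhammer ℂ j).eval (2 * μ + 1) := by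
    rw [e]; field_simp
  rw [e2]
  have h : (Nat.factorial j : ℂ) ≠ 0 := by exact_mod_cast Nat.factorial_ne_zero j
  field_simp

lemma whS_neg (a : ℂ) (x : ℝ) (n : ℕ) :
    whS a x (-(n / 2 : ℂ)) = (ascPochhammer ℂ n).eval (a - n / 2) * (x : ℂ) ^ n *
      whS a x (n / 2 : ℂ) := by
  unfold whS
  rw [← (whT_summable a x (-(n / 2 : ℂ))).sum_add_tsum_nat_add n, ← tsum_mul_left]
  have z : ∑ j ∈ Finset.range n, whT a x j (-(n / 2 : ℂ)) = 0 := by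
    refine Finset.sum_eq_zero fun j hj => ?_
    have hj := Finset.mem_range.mp hj
    unfold whT
    obtain ⟨m, rfl⟩ := Nat.exists_eq_add_of_lt hj
    have : 2 * -(((j + m + 1 : ℕ) : ℂ) / 2) + 1 + j = -(m : ℂ) := by push_cast; ring
    rw [this, Complex.Gamma_neg_nat_eq_zero]
    simp
  rw [z, zero_add]
  refine tsum_congr fun k => ?_
  unfold whT
  have e1 : 2 * -((n : ℂ) / 2) + 1 + ((k + n : ℕ) : ℂ) = (k : ℂ) + 1 := by push_cast; ring
  have e2 : 2 * ((n : ℂ) / 2) + 1 + (k : ℂ) = ((n + k : ℕ) : ℂ) + 1 := by push_cast; ring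
  rw [e1, e2, Complex.Gamma_nat_eq_factorial, Complex.Gamma_nat_eq_factorial, add_comm k n,
    ← ascPochhammer_mul]
  have e3 : a + (n : ℂ) / 2 = a + -((n : ℂ) / 2) + n := by ring
  rw [e3]
  simp only [Polynomial.eval_mul, Polynomial.eval_comp, Polynomial.eval_add, Polynomial.eval_X,
    Polynomial.eval_natCast]
  rw [← sub_eq_add_neg, pow_add]
  ring

lemma whR_neg (a : ℂ) (x : ℝ) (hx : 0 < x) (n : ℕ) :
    whR a x (-(n / 2 : ℂ)) = (ascPochhammer ℂ n).eval (a - n / 2) * whR a x (n / 2 : ℂ) := by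
  unfold whR
  rw [whS_neg]
  have : Complex.exp ((1/2 + (n / 2 : ℂ)) * (Real.log x : ℂ)) =
      Complex.exp ((1/2 + -(n / 2 : ℂ)) * (Real.log x : ℂ)) * (x : ℂ) ^ n := by
    have h : (x : ℂ) = Complex.exp (Real.log x : ℂ) := by
      rw [← Complex.ofReal_exp, Real.exp_log hx]
    conv_rhs => rw [h, ← Complex.exp_nat_mul, ← Complex.exp_add]
    congr 1
    ring
  rw [this]
  ring

noncomputable def whG (a : ℂ) (x : ℝ) (μ : ℂ) : ℂ :=
  whR a x (-μ) * (Complex.Gamma (a + μ))⁻¹ - whR a x μ * (Complex.Gamma (a - μ))⁻¹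

lemma whG_diff (a : ℂ) (x : ℝ) : Differentiable ℂ (whG a x) := by
  have h1 : Differentiable ℂ (fun μ : ℂ => (Complex.Gamma (a + μ))⁻¹) :=
    Complex.differentiable_one_div_Gamma.comp (by fun_prop : Differentiable ℂ (fun μ : ℂ => a + μ))
  have h2 : Differentiable ℂ (fun μ : ℂ => (Complex.Gamma (a - μ))⁻¹) :=
    Complex.differentiable_one_div_Gamma.comp (by fun_prop : Differentiable ℂ (fun μ : ℂ => a - μ))
  have h3 := whR_diff a x
  have h4 : Differentiable ℂ (fun μ : ℂ => whR a x (-μ)) := h3.comp differentiable_neg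
  exact (h4.mul h1).sub (h3.mul h2)

lemma whG_odd (a : ℂ) (x : ℝ) (μ : ℂ) : whG a x (-μ) = - whG a x μ := by
  unfold whG
  rw [neg_neg, sub_neg_eq_add, ← sub_eq_add_neg]
  ring

lemma whG_nat (a : ℂ) (x : ℝ) (hx : 0 < x) (n : ℕ) : whG a x (n / 2 : ℂ) = 0 := by
  unfold whG
  rw [whR_neg a x hx, wh_gamma_inv (a - n / 2) n]
  have : a - (n : ℂ) / 2 + n = a + n / 2 := by ring
  rw [this]
  ring

lemma whG_int (a : ℂ) (x : ℝ) (hx : 0 < x) (n : ℤ) : whG a x (n / 2 : ℂ) = 0 := by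
  obtain ⟨m, rfl | rfl⟩ := n.eq_nat_or_neg
  · have := whG_nat a x hx m
    rwa [Int.cast_natCast]
  · have := whG_odd a x (m / 2)
    rw [whG_nat a x hx m, neg_zero] at this
    rw [← this]
    push_cast
    rw [neg_div]

/-- removable singularities for a quotient with simple zeros in the denominator -/
lemma wh_quot (g s : ℂ → ℂ) (hg : Differentiable ℂ g) (hs : Differentiable ℂ s)
    (h0 : ∀ c, s c = 0 → g c = 0) (h1 : ∀ c, s c = 0 → deriv s c ≠ 0) :
    ∃ F : ℂ → ℂ, Differentiable ℂ F ∧ ∀ c, s c ≠ 0 → F c = g c / s c := by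
  classical
  refine ⟨fun c => if s c = 0 then deriv g c / deriv s c else g c / s c, ?_, ?_⟩
  swap
  · intro c hc; simp [hc]
  intro c
  by_cases hc : s c = 0
  · have dg : ∀ f : ℂ → ℂ, Differentiable ℂ f → DifferentiableAt ℂ (dslope f c) c := fun f hf =>
      ((Complex.differentiableOn_dslope (s := Set.univ) Filter.univ_mem).2
        hf.differentiableOn).differentiableAt Filter.univ_mem
    have hne : dslope s c c ≠ 0 := by rw [dslope_same]; exact h1 c hc
    have hq := (dg g hg).div (dg s hs) hne
    refine hq.congr_of_eventuallyEq ?_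
    filter_upwards [(dg s hs).continuousAt.eventually_ne hne] with z hz
    by_cases hzc : z = c
    · subst hzc; simp [hc]
    · have es : s z = (z - c) * dslope s c z := by
        have := sub_smul_dslope s c z; rw [hc, sub_zero, smul_eq_mul] at this; exact this.symm
      have eg : g z = (z - c) * dslope g c z := by
        have := sub_smul_dslope g c z; rw [h0 c hc, sub_zero, smul_eq_mul] at this; exact this.symm
      have hzc' : z - c ≠ 0 := sub_ne_zero.mpr hzc
      have : s z ≠ 0 := by rw [es]; exact mul_ne_zero hzc' hz
      simp only [this, if_false, Pi.div_apply]
      rw [es, eg, mul_div_mul_left _ _ hzc']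
  · refine ((hg c).div (hs c) hc).congr_of_eventuallyEq ?_
    filter_upwards [(hs c).continuousAt.eventually_ne hc] with z hz
    simp [hz]

lemma wh_sin_zero (c : ℂ) (h : Complex.sin (Real.pi * (2 * c)) = 0) : ∃ n : ℤ, 2 * c = n := by
  obtain ⟨k, hk⟩ := Complex.sin_eq_zero_iff.mp h
  have hpi : (Real.pi : ℂ) ≠ 0 := by exact_mod_cast Real.pi_ne_zero
  exact ⟨k, mul_left_cancel₀ hpi (by rw [hk]; ring)⟩

lemma wh_exists (κ : ℂ) (x : ℝ) (hx : 0 < x) : ∃ F : ℂ → ℂ, Differentiable ℂ F ∧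
    ∀ μ : ℂ, (∀ n : ℤ, 2*μ ≠ (n:ℂ)) → F μ = whittakerW κ μ x := by
  have hpi : (Real.pi : ℂ) ≠ 0 := by exact_mod_cast Real.pi_ne_zero
  obtain ⟨F, hF, hF2⟩ := wh_quot (fun μ => Real.pi * whG (1/2 - κ) x μ)
    (fun μ => Complex.sin (Real.pi * (2 * μ))) ((whG_diff _ x).const_mul _) (by fun_prop)
    (by
      intro c hc
      obtain ⟨n, hn⟩ := wh_sin_zero c hc
      have : c = n / 2 := by rw [← hn]; ring
      rw [this, whG_int _ x hx, mul_zero])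
    (by
      intro c hc
      have hd : HasDerivAt (fun μ : ℂ => Complex.sin (Real.pi * (2 * μ)))
          (Complex.cos (Real.pi * (2 * c)) * (Real.pi * (2 * 1))) c :=
        (((hasDerivAt_id c).const_mul 2).const_mul (Real.pi : ℂ)).csin
      rw [hd.deriv]
      have hcos : Complex.cos (Real.pi * (2 * c)) ≠ 0 := by
        intro h
        have := Complex.sin_sq_add_cos_sq (Real.pi * (2 * c))
        rw [h, hc] at this
        norm_num at this
      exact mul_ne_zero hcos (mul_ne_zero hpi (by norm_num)))
  refine ⟨F, hF, fun μ hμ => ?_⟩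
  have hs : Complex.sin (Real.pi * (2 * μ)) ≠ 0 := fun h => by
    obtain ⟨n, hn⟩ := wh_sin_zero μ h
    exact hμ n hn
  rw [hF2 μ hs]
  unfold whittakerW whG
  have hμ' : ∀ n : ℤ, 2 * (-μ) ≠ (n:ℂ) := fun n hn => hμ (-n) (by
    push_cast; linear_combination -hn)
  rw [whM_eq κ μ x hμ, whM_eq κ (-μ) x hμ']
  have r1 := Complex.Gamma_mul_Gamma_one_sub (2 * μ)
  have r2 := Complex.Gamma_mul_Gamma_one_sub (-(2 * μ))
  have q1 : 2 * -μ + 1 = 1 - 2 * μ := by ring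
  have q2 : 1 - -(2 * μ) = 2 * μ + 1 := by ring
  have q3 : (Real.pi : ℂ) * (-(2 * μ)) = -(Real.pi * (2 * μ)) := by ring
  rw [q2, q3, Complex.sin_neg] at r2
  rw [q1]
  have t1 : ∀ A B : ℂ, Complex.Gamma (-(2*μ)) / A * (Complex.Gamma (2 * μ + 1) * B) =
      (Real.pi / -Complex.sin (Real.pi * (2 * μ))) * (B * A⁻¹) := by
    intro A B; rw [← r2]; ring
  have t2 : ∀ A B : ℂ, Complex.Gamma (2*μ) / A * (Complex.Gamma (1 - 2 * μ) * B) =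
      (Real.pi / Complex.sin (Real.pi * (2 * μ))) * (B * A⁻¹) := by
    intro A B; rw [← r1]; ring
  rw [t1, t2, div_neg]
  ring

lemma wh_unique (F G : ℂ → ℂ) (hF : Differentiable ℂ F) (hG : Differentiable ℂ G)
    (h : ∀ μ : ℂ, (∀ n : ℤ, 2*μ ≠ (n:ℂ)) → F μ = G μ) : F = G := by
  have hd : Dense (Set.range (fun n : ℤ => (n : ℂ) / 2))ᶜ :=
    (Set.countable_range _).dense_compl ℝ
  refine Continuous.ext_on hd hF.continuous hG.continuous fun μ hμ => h μ fun n hn => hμ ⟨n, ?_⟩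
  beta_reduce
  rw [← hn]; ring

lemma whW_even (κ μ : ℂ) (x : ℝ) : whittakerW κ (-μ) x = whittakerW κ μ x := by
  unfold whittakerW
  rw [neg_neg, mul_neg, neg_neg, sub_neg_eq_add, ← sub_eq_add_neg, add_comm]

/-- For fixed real `κ` and `x₀ > 0` there is a unique entire function extending
`μ ↦ W_{κ,μ}(x₀)`, and it is even in `μ`. -/
theorem stmt_12 (κ x₀ : ℝ) (hx : 0 < x₀) :
    (∃! F : ℂ → ℂ, Differentiable ℂ F ∧
      ∀ μ : ℂ, (∀ n : ℤ, 2*μ ≠ (n:ℂ)) → F μ = whittakerW (κ:ℂ) μ x₀) ∧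
    (∀ F : ℂ → ℂ, Differentiable ℂ F →
      (∀ μ : ℂ, (∀ n : ℤ, 2*μ ≠ (n:ℂ)) → F μ = whittakerW (κ:ℂ) μ x₀) →
      ∀ μ : ℂ, F (-μ) = F μ) := by
  constructor
  · obtain ⟨F, hF, hF2⟩ := wh_exists κ x₀ hx
    refine ⟨F, ⟨hF, hF2⟩, fun G hG => ?_⟩
    exact wh_unique G F hG.1 hF fun μ hμ => by rw [hG.2 μ hμ, hF2 μ hμ]
  · intro F hF hF2 μ
    have := wh_unique (fun μ => F (-μ)) F (hF.comp differentiable_neg) hF fun ν hν => by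
      have hν' : ∀ n : ℤ, 2 * (-ν) ≠ (n:ℂ) := fun n hn => hν (-n) (by
        push_cast; linear_combination -hn)
      rw [hF2 _ hν', hF2 _ hν, whW_even]
    exact congrFun this μ
end

section
/- Fix a real number κ and a real x₀ > 0, and suppose F : ℂ → ℂ is an entire function such that F(μ) = W_{κ,μ}(x₀) for every complex μ with 2μ not an integer. Then every zero ρ of F lies on the real or the imaginary axis: if F(ρ) = 0 then Re(ρ) = 0 or Im(ρ) = 0. -/
section WhittakerAux
open Complex Filter Topology MeasureTheory Set

noncomputable def kc (a b : ℂ) (j : ℕ) : ℂ :=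
  (Polynomial.eval a (ascPochhammer ℂ j)) / ((Polynomial.eval b (ascPochhammer ℂ j)) * (Nat.factorial j : ℂ))

noncomputable def kK (a b z : ℂ) : ℂ := ∑' j : ℕ, kc a b j * z ^ j

lemma add_nat_ne {b : ℂ} (hb : b.im ≠ 0) (n : ℕ) : b + n ≠ 0 := by
  intro h
  apply hb
  have := congrArg Complex.im h
  simpa using this

lemma asc_ne {b : ℂ} (hb : b.im ≠ 0) (n : ℕ) : Polynomial.eval b (ascPochhammer ℂ n) ≠ 0 := by
  induction n with
  | zero => simp
  | succ n ih =>
    rw [ascPochhammer_succ_eval]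
    exact mul_ne_zero ih (add_nat_ne hb n)

lemma kc_zero (a b : ℂ) : kc a b 0 = 1 := by simp [kc]

lemma kc_succ (a : ℂ) {b : ℂ} (hb : b.im ≠ 0) (j : ℕ) :
    kc a b (j+1) * ((b + j) * (j + 1)) = kc a b j * (a + j) := by
  unfold kc
  rw [ascPochhammer_succ_eval, ascPochhammer_succ_eval, Nat.factorial_succ]
  have h1 := asc_ne hb j
  have h2 := add_nat_ne hb j
  have h3 : (j.factorial : ℂ) ≠ 0 := by exact_mod_cast j.factorial_ne_zero
  have h4 : (j:ℂ) + 1 ≠ 0 := by exact_mod_cast Nat.succ_ne_zero j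
  push_cast
  field_simp

lemma kc_shift (a : ℂ) {b : ℂ} (hb : b.im ≠ 0) (j : ℕ) :
    (a / b) * kc (a+1) (b+1) j = (j + 1) * kc a b (j+1) := by
  unfold kc
  have e : ∀ c : ℂ, Polynomial.eval c (ascPochhammer ℂ (j+1)) = c * Polynomial.eval (c+1) (ascPochhammer ℂ j) := by
    intro c
    rw [ascPochhammer_succ_left]
    simp
  rw [e, e, Nat.factorial_succ]
  have h1 := asc_ne (b := b+1) (by simpa using hb) j
  have h2 : b ≠ 0 := by intro h; simp [h] at hb
  have h3 : (j.factorial : ℂ) ≠ 0 := by exact_mod_cast j.factorial_ne_zero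
  have h4 : (j:ℂ) + 1 ≠ 0 := by exact_mod_cast Nat.succ_ne_zero j
  push_cast
  field_simp

lemma kc_bshift (a : ℂ) {b : ℂ} (hb : b.im ≠ 0) (j : ℕ) :
    (b + j) * kc a (b+1) j = b * kc a b j := by
  induction j with
  | zero => simp [kc_zero]
  | succ j ih =>
    have h1 := kc_succ a hb j
    have h2 := kc_succ a (b := b+1) (by simpa using hb) j
    have h5 := add_nat_ne hb j
    have h4 : (j:ℂ) + 1 ≠ 0 := by exact_mod_cast Nat.succ_ne_zero j
    apply mul_left_cancel₀ h4
    apply mul_left_cancel₀ h5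
    push_cast
    linear_combination (b + j) * h2 - b * h1 + (a+j) * ih

/-- ratio test -/
lemma kc_summable (a : ℂ) {b : ℂ} (hb : b.im ≠ 0) (z : ℂ) :
    Summable (fun j => ‖kc a b j * z ^ j‖) := by
  by_cases hz : z = 0
  · subst hz
    apply summable_of_ne_finset_zero (s := {0})
    intro j hj
    simp at hj
    simp [hj]
  by_cases ha : ∃ n : ℕ, a + n = 0
  · obtain ⟨n, hn⟩ := ha
    have key : ∀ k, kc a b (n + 1 + k) = 0 := by
      intro k
      have hs : ∀ m : ℕ, kc a b m * (a+m) = 0 → kc a b (m+1) = 0 := by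
        intro m hm
        have h := kc_succ a hb m
        rw [hm] at h
        have h4 : (m:ℂ) + 1 ≠ 0 := by exact_mod_cast Nat.succ_ne_zero m
        exact (mul_eq_zero.mp h).resolve_right (mul_ne_zero (add_nat_ne hb m) h4)
      induction k with
      | zero => exact hs n (by rw [hn, mul_zero])
      | succ k ih => exact hs (n+1+k) (by rw [ih, zero_mul])
    apply summable_of_ne_finset_zero (s := Finset.range (n+1))
    intro j hj
    simp at hj
    obtain ⟨k, rfl⟩ := Nat.exists_eq_add_of_le hj
    simp [key]
  · push Not at ha
    have hne : ∀ j, kc a b j ≠ 0 := by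
      intro j
      induction j with
      | zero => simp [kc_zero]
      | succ j ih =>
        have h := kc_succ a hb j
        intro h0
        rw [h0, zero_mul] at h
        exact (mul_ne_zero ih (ha j)) h.symm
    apply summable_of_ratio_test_tendsto_lt_one (l := 0) (by norm_num)
    · exact Eventually.of_forall fun j => by
        simp [hne j, hz]
    have e : ∀ j : ℕ, ‖‖kc a b (j+1) * z ^ (j+1)‖‖ / ‖‖kc a b j * z ^ j‖‖
        = ‖((a + j) / (b + j)) * (z / (j + 1))‖ := by
      intro j
      rw [norm_norm, norm_norm, ← norm_div]
      congr 1
      have h4 : (j:ℂ) + 1 ≠ 0 := by exact_mod_cast Nat.succ_ne_zero j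
      have h5 := add_nat_ne hb j
      have h6 := hne j
      have h7 : z ^ j ≠ 0 := pow_ne_zero _ hz
      rw [pow_succ]
      field_simp
      linear_combination kc_succ a hb j
    rw [tendsto_congr e]
    rw [← norm_zero (E := ℂ)]
    apply Tendsto.norm
    have t0 : Tendsto (fun j : ℕ => (1:ℂ) / ((j:ℂ) + 1)) atTop (𝓝 0) := tendsto_one_div_add_atTop_nhds_zero_nat
    have t1 : Tendsto (fun j : ℕ => ((j:ℂ))⁻¹) atTop (𝓝 0) := by
      exact tendsto_inv_atTop_nhds_zero_nat 
    have t2 : Tendsto (fun j : ℕ => (a + j) / (b + j)) atTop (𝓝 1) := by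
      have : Tendsto (fun j : ℕ => (a * ((j:ℂ))⁻¹ + 1) / (b * ((j:ℂ))⁻¹ + 1)) atTop (𝓝 ((a * 0 + 1) / (b * 0 + 1))) := by
        apply Tendsto.div
        · exact (t1.const_mul a).add_const 1
        · exact (t1.const_mul b).add_const 1
        · simp
      simp only [mul_zero, zero_add, div_one] at this
      refine this.congr' ?_
      filter_upwards [eventually_gt_atTop 0] with j hj
      have : (j:ℂ) ≠ 0 := by exact_mod_cast hj.ne'
      have e1 : a + j = (a * (j:ℂ)⁻¹ + 1) * j := by field_simp
      have e2 : b + j = (b * (j:ℂ)⁻¹ + 1) * j := by field_simp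
      rw [e1, e2, mul_div_mul_right _ _ this]
    have := t2.mul (t0.const_mul z)
    simp only [mul_zero, one_mul, mul_one_div] at this
    exact this

lemma kK_hasSum (a : ℂ) {b : ℂ} (hb : b.im ≠ 0) (z : ℂ) :
    HasSum (fun j => kc a b j * z ^ j) (kK a b z) := 
  (kc_summable a hb z).of_norm.hasSum

/-- derivative of the Kummer series -/
lemma kK_hasDerivAt (a : ℂ) {b : ℂ} (hb : b.im ≠ 0) (z : ℂ) :
    HasDerivAt (kK a b) ((a / b) * kK (a+1) (b+1) z) z := by
  have hb1 : (b+1).im ≠ 0 := by simpa using hb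
  have hsum : ∑' j : ℕ, kc a b j * (j * z ^ (j-1)) = (a / b) * kK (a+1) (b+1) z := by
    have h := ((kK_hasSum (a+1) hb1 z).mul_left (a/b))
    have h2 : HasSum (fun j : ℕ => kc a b (j+1) * ((j+1 : ℕ) * z ^ (j+1-1))) ((a / b) * kK (a+1) (b+1) z) := by
      convert! h using 2 with j
      rw [← mul_assoc (a/b), kc_shift a hb]
      push_cast
      ring
    have h3 := (hasSum_nat_add_iff (f := fun j : ℕ => kc a b j * (j * z ^ (j-1))) 1).mp h2
    simp at h3
    exact h3.tsum_eq
  rw [← hsum]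
  set R : ℝ := ‖z‖ + 1
  have hR : 0 < R := by positivity
  apply hasDerivAt_tsum_of_isPreconnected (u := fun j : ℕ => ‖kc a b j * (j * (R:ℂ) ^ (j-1))‖) (t := Metric.ball 0 R)
    (g := fun j z => kc a b j * z ^ j) (g' := fun j z => kc a b j * (j * z ^ (j-1))) (y₀ := 0)
  · have h := ((kc_summable (a+1) hb1 (R:ℂ)).mul_left ‖a/b‖)
    rw [← summable_nat_add_iff 1]
    convert! h using 2 with j
    rw [← norm_mul, ← mul_assoc (a/b), kc_shift a hb]
    congr 1
    push_cast
    ring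
  · exact Metric.isOpen_ball
  · exact (convex_ball _ _).isPreconnected
  · intro n y hy
    exact (hasDerivAt_pow n y).const_mul _
  · intro n y hy
    rw [norm_mul, norm_mul, norm_mul, norm_mul]
    simp only [norm_pow]
    have : ‖y‖ ≤ ‖(R:ℂ)‖ := by
      rw [Complex.norm_real, Real.norm_of_nonneg hR.le]
      simpa using (mem_ball_zero_iff.mp hy).le
    gcongr
  · simpa using hR
  · exact (kc_summable a hb 0).of_norm
  · simp [R]

/-- Kummer ODE -/
lemma kK_ode (a : ℂ) {b : ℂ} (hb : b.im ≠ 0) (z : ℂ) :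
    z * ((a / b) * (((a+1) / (b+1)) * kK (a+1+1) (b+1+1) z)) + (b - z) * ((a / b) * kK (a+1) (b+1) z)
      = a * kK a b z := by
  have hb1 : (b+1).im ≠ 0 := by simpa using hb
  have hb2 : (b+1+1).im ≠ 0 := by simpa using hb
  have h0 := kK_hasSum a hb z
  have h1 := (kK_hasSum (a+1) hb1 z).mul_left (a/b)
  have h2 := ((kK_hasSum (a+1+1) hb2 z).mul_left ((a+1)/(b+1))).mul_left (a/b)
  have s1 : HasSum (fun j : ℕ => (j:ℂ) * kc a b j * z ^ j) (z * ((a / b) * kK (a+1) (b+1) z)) := by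
    have := h1.mul_left z
    have h2 : HasSum (fun j : ℕ => ((j+1 : ℕ):ℂ) * kc a b (j+1) * z ^ (j+1)) (z * ((a / b) * kK (a+1) (b+1) z)) := by
      convert! this using 2 with j
      rw [← mul_assoc (a/b), kc_shift a hb]
      push_cast
      ring
    have h3 := (hasSum_nat_add_iff (f := fun j : ℕ => (j:ℂ) * kc a b j * z ^ j) 1).mp h2
    simpa using h3
  have s2 : HasSum (fun j : ℕ => (j:ℂ) * ((j+1) * kc a b (j+1)) * z ^ j)
      (z * ((a / b) * (((a+1) / (b+1)) * kK (a+1+1) (b+1+1) z))) := by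
    have := h2.mul_left z
    have h2 : HasSum (fun j : ℕ => ((j+1 : ℕ):ℂ) * (((j+1:ℕ)+1) * kc a b (j+1+1)) * z ^ (j+1)) (z * ((a / b) * (((a+1) / (b+1)) * kK (a+1+1) (b+1+1) z))) := by
      convert! this using 2 with j
      have e1 := kc_shift (a+1) hb1 j
      have e2 := kc_shift a hb (j+1)
      rw [← e2, ← mul_assoc ((a+1)/(b+1)), e1]
      push_cast
      ring
    have h3 := (hasSum_nat_add_iff (f := fun j : ℕ => (j:ℂ) * ((j+1) * kc a b (j+1)) * z ^ j) 1).mp h2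
    simpa using h3
  have s3 : HasSum (fun j : ℕ => b * ((j+1) * kc a b (j+1) * z ^ j)) (b * ((a / b) * kK (a+1) (b+1) z)) := by
    apply HasSum.mul_left
    convert! h1 using 2 with j
    rw [← mul_assoc (a/b), kc_shift a hb]
  have tot := ((s2.add s3).sub s1).sub (h0.mul_left a)
  have z0 : HasSum (fun j : ℕ => (0:ℂ)) 0 := hasSum_zero
  have := tot.unique (by
    convert! z0 using 2 with j
    have := kc_succ a hb j
    linear_combination z ^ j * this)
  linear_combination this

/-- lowering b -/
lemma kK_bshift (a : ℂ) {b : ℂ} (hb : b.im ≠ 0) (z : ℂ) :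
    b * kK a (b+1) z + z * ((a / (b+1)) * kK (a+1) (b+1+1) z) = b * kK a b z := by
  have hb1 : (b+1).im ≠ 0 := by simpa using hb
  have hb2 : (b+1+1).im ≠ 0 := by simpa using hb
  have h1 := (kK_hasSum (a+1) hb2 z).mul_left (a/(b+1))
  have s1 : HasSum (fun j : ℕ => (j:ℂ) * kc a (b+1) j * z ^ j) (z * ((a / (b+1)) * kK (a+1) (b+1+1) z)) := by
    have := h1.mul_left z
    have h2 : HasSum (fun j : ℕ => ((j+1 : ℕ):ℂ) * kc a (b+1) (j+1) * z ^ (j+1)) (z * ((a / (b+1)) * kK (a+1) (b+1+1) z)) := by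
      convert! this using 2 with j
      rw [← mul_assoc (a/(b+1)), kc_shift a hb1]
      push_cast
      ring
    have h3 := (hasSum_nat_add_iff (f := fun j : ℕ => (j:ℂ) * kc a (b+1) j * z ^ j) 1).mp h2
    simpa using h3
  have t1 := ((kK_hasSum a hb1 z).mul_left b).add s1
  refine t1.unique ?_
  convert! (kK_hasSum a hb z).mul_left b using 2 with j
  linear_combination z ^ j * kc_bshift a hb j

lemma kK_zero (a b : ℂ) : kK a b 0 = 1 := by
  unfold kK
  rw [tsum_eq_single 0]
  · simp [kc_zero]
  · intro j hj
    simp [hj]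

/-! ### The Laplace integral -/

lemma one_add_rpow_le (c : ℝ) {x : ℝ} (hx : 0 < x) :
    ∃ C : ℝ, 0 < C ∧ ∀ t : ℝ, 0 ≤ t → (1 + t) ^ c ≤ C * Real.exp (x * t) := by
  set ε : ℝ := x / (|c| + 1) with hε
  have hc : 0 < |c| + 1 := by positivity
  have hε0 : 0 < ε := by positivity
  refine ⟨Real.exp (|c| * (ε - 1 - Real.log ε)), Real.exp_pos _, fun t ht => ?_⟩
  have h1 : (1 + t) ^ c ≤ (1 + t) ^ |c| :=
    Real.rpow_le_rpow_of_exponent_le (by linarith) (le_abs_self c)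
  refine h1.trans ?_
  rw [Real.rpow_def_of_pos (by linarith), ← Real.exp_add]
  apply Real.exp_le_exp.mpr
  have h2 : Real.log (ε * (1 + t)) ≤ ε * (1 + t) - 1 := Real.log_le_sub_one_of_pos (by positivity)
  rw [Real.log_mul hε0.ne' (by linarith)] at h2
  have h3 : Real.log (1 + t) * |c| ≤ (ε * (1+t) - 1 - Real.log ε) * |c| := by
    apply mul_le_mul_of_nonneg_right _ (abs_nonneg c)
    linarith
  have h4 : ε * |c| ≤ x := by
    rw [hε, div_mul_eq_mul_div, div_le_iff₀ hc]
    nlinarith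
  have h5 : ε * |c| * t ≤ x * t := mul_le_mul_of_nonneg_right h4 ht
  nlinarith

/-- the integrand -/
noncomputable def kg (a b : ℂ) (x t : ℝ) : ℂ :=
  ((Real.exp (-(x * t)) : ℝ) : ℂ) * (t:ℂ) ^ (a - 1) * ((1 + t : ℝ) : ℂ) ^ (b - a - 1)

lemma kg_norm (a b : ℂ) (x : ℝ) {t : ℝ} (ht : 0 < t) :
    ‖kg a b x t‖ = Real.exp (-(x * t)) * t ^ (a.re - 1) * (1 + t) ^ ((b - a).re - 1) := by
  unfold kg
  rw [norm_mul, norm_mul, Complex.norm_real, Complex.norm_cpow_eq_rpow_re_of_pos ht,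
    Complex.norm_cpow_eq_rpow_re_of_pos (by linarith), Real.norm_of_nonneg (Real.exp_pos _).le]
  simp

lemma kg_cont (a b : ℂ) (x : ℝ) : ContinuousOn (kg a b x) (Ioi 0) := by
  unfold kg
  apply ContinuousOn.mul
  · apply ContinuousOn.mul
    · fun_prop
    · intro t ht
      apply ContinuousAt.continuousWithinAt
      exact Complex.continuousAt_ofReal_cpow_const _ _ (Or.inr (ne_of_gt ht))
  · intro t ht
    apply ContinuousAt.continuousWithinAt
    have : ContinuousAt (fun s : ℝ => ((s : ℝ) : ℂ) ^ (b - a - 1)) (1 + t) :=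
      Complex.continuousAt_ofReal_cpow_const _ _ (Or.inr (by have : 0 < t := ht; linarith))
    exact ContinuousAt.comp (f := fun t : ℝ => 1 + t) (x := t) this (by fun_prop)

lemma kg_meas (a b : ℂ) (x : ℝ) : AEStronglyMeasurable (kg a b x) (volume.restrict (Ioi 0)) :=
  (kg_cont a b x).aestronglyMeasurable measurableSet_Ioi

lemma int_real {α : ℝ} (hα : 0 < α) {x : ℝ} (hx : 0 < x) :
    IntegrableOn (fun t : ℝ => Real.exp (-(x * t)) * t ^ (α - 1)) (Ioi 0) := by
  have := integrableOn_rpow_mul_exp_neg_mul_rpow (p := 1) (s := α - 1) (b := x) (by linarith) (by norm_num) hx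
  refine this.congr_fun (fun t _ => ?_) measurableSet_Ioi
  simp [mul_comm]

lemma kg_int {a : ℂ} (b : ℂ) (ha : 0 < a.re) {x : ℝ} (hx : 0 < x) :
    IntegrableOn (kg a b x) (Ioi 0) := by
  obtain ⟨C, hC, hb⟩ := one_add_rpow_le ((b - a).re - 1) (x := x/2) (by linarith)
  have h := (int_real ha (x := x/2) (by linarith)).const_mul C
  refine Integrable.mono' h (kg_meas a b x) ?_
  refine (ae_restrict_iff' measurableSet_Ioi).mpr (Eventually.of_forall fun t ht => ?_)
  have ht : 0 < t := ht
  rw [kg_norm a b x ht]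
  have e : Real.exp (-(x * t)) = Real.exp (-(x/2*t)) * Real.exp (-(x/2*t)) := by
    rw [← Real.exp_add]; ring_nf
  have e2 : Real.exp (-(x/2*t)) * Real.exp (x/2*t) = 1 := by
    rw [← Real.exp_add]; simp
  calc _ ≤ Real.exp (-(x * t)) * t ^ (a.re - 1) * (C * Real.exp (x/2*t)) := by
        gcongr
        exact hb t ht.le
    _ = C * (Real.exp (-(x/2 * t)) * t ^ (a.re - 1)) * (Real.exp (-(x/2*t)) * Real.exp (x/2*t)) := by
        rw [e]; ring
    _ = _ := by rw [e2, mul_one]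

noncomputable def kI (a b : ℂ) (x : ℝ) : ℂ := ∫ t in Ioi (0:ℝ), kg a b x t

lemma kg_shift (a b : ℂ) (x : ℝ) {t : ℝ} (ht : 0 < t) :
    kg (a+1) (b+1) x t = t * kg a b x t := by
  unfold kg
  have h : (t:ℂ) ≠ 0 := by exact_mod_cast ht.ne'
  rw [show a + 1 - 1 = (a - 1) + 1 by ring, Complex.cpow_add _ _ h, Complex.cpow_one,
    show b + 1 - (a + 1) - 1 = b - a - 1 by ring]
  ring

lemma kI_hasDerivAt {a : ℂ} (b : ℂ) (ha : 0 < a.re) {x : ℝ} (hx : 0 < x) :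
    HasDerivAt (kI a b) (- kI (a+1) (b+1) x) x := by
  have ha1 : 0 < (a+1).re := by simp; linarith
  have key := hasDerivAt_integral_of_dominated_loc_of_deriv_le (μ := volume.restrict (Ioi (0:ℝ)))
    (F := kg a b) (F' := fun x t => - kg (a+1) (b+1) x t) (x₀ := x) (s := Ioi (x/2))
    (bound := fun t => ‖kg (a+1) (b+1) (x/2) t‖) (Ioi_mem_nhds (by linarith))
    (Eventually.of_forall fun y => kg_meas a b y) (kg_int b ha hx) (kg_meas _ _ _).neg ?_
    (kg_int (b+1) ha1 (by linarith)).norm ?_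
  · have := key.2
    rw [integral_neg] at this
    exact this
  · refine (ae_restrict_iff' measurableSet_Ioi).mpr (Eventually.of_forall fun t ht y hy => ?_)
    have ht : 0 < t := ht
    have hy : x/2 < y := hy
    rw [norm_neg, kg_norm _ _ _ ht, kg_norm _ _ _ ht]
    gcongr
  · refine (ae_restrict_iff' measurableSet_Ioi).mpr (Eventually.of_forall fun t ht y hy => ?_)
    rw [kg_shift a b y ht]
    unfold kg
    have h1 : HasDerivAt (fun y : ℝ => Real.exp (-(y * t))) (Real.exp (-(y * t)) * (-(1 * t))) y :=
      (((hasDerivAt_id y).mul_const t).neg).exp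
    have h2 := ((h1.ofReal_comp).mul_const ((t:ℂ) ^ (a - 1))).mul_const (((1 + t : ℝ) : ℂ) ^ (b - a - 1))
    convert! h2 using 1
    push_cast
    ring

lemma kI_ode {a : ℂ} (b : ℂ) (ha : 0 < a.re) {x : ℝ} (hx : 0 < x) :
    x * kI (a+1+1) (b+1+1) x - (b - x) * kI (a+1) (b+1) x = a * kI a b x := by
  have ha1 : 0 < (a+1).re := by simp; linarith
  have ha2 : 0 < (a+1+1).re := by simp; linarith
  have ha0 : a ≠ 0 := by intro h; simp [h] at ha
  have i0 := (kg_int b ha hx).const_mul a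
  have i1 := (kg_int (b+1) ha1 hx).const_mul (b - x)
  have i2 := (kg_int (b+1+1) ha2 hx).const_mul (x:ℂ)
  set f : ℝ → ℂ := fun t => kg (a+1) (b+1+1) x t with hf
  have hD : ∀ t ∈ Ioi (0:ℝ), HasDerivAt f
      (a * kg a b x t + (b - x) * kg (a+1) (b+1) x t - x * kg (a+1+1) (b+1+1) x t) t := by
    intro t ht
    have ht : 0 < t := ht
    have hne : (t:ℂ) ≠ 0 := by exact_mod_cast ht.ne'
    have hne1 : ((1+t:ℝ):ℂ) ≠ 0 := by exact_mod_cast (by linarith : (1+t) ≠ 0)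
    have h1 : HasDerivAt (fun t : ℝ => Real.exp (-(x * t))) (Real.exp (-(x * t)) * (-(x * 1))) t :=
      (((hasDerivAt_id t).const_mul x).neg).exp
    have h2 : HasDerivAt (fun t : ℝ => (t:ℂ) ^ a) (a * (t:ℂ) ^ (a-1) * 1) t := by
      have := ((hasDerivAt_id (t:ℂ)).cpow_const (c := a) (Or.inl (by simpa using ht))).comp_ofReal
      simpa using this
    have h3 : HasDerivAt (fun t : ℝ => ((1+t:ℝ):ℂ) ^ (b-a)) ((b-a) * ((1+t:ℝ):ℂ) ^ (b-a-1) * 1) t := by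
      have := (((hasDerivAt_id (t:ℂ)).const_add 1).cpow_const (c := b-a) (Or.inl (by
        show 0 < (1 + id (t:ℂ)).re; simp; linarith))).comp_ofReal
      simpa using this
    have h4 := (h1.ofReal_comp.mul h2).mul h3
    rw [kg_shift (a+1) (b+1) x ht, kg_shift a b x ht]
    have e : f = ((fun t : ℝ => ((Real.exp (-(x * t)) : ℝ) : ℂ)) * (fun t : ℝ => (t:ℂ) ^ a)) * fun t : ℝ => ((1+t:ℝ):ℂ) ^ (b-a) := by
      funext s
      simp only [hf, kg, Pi.mul_apply]
      rw [show a + 1 - 1 = a by ring, show b + 1 + 1 - (a+1) - 1 = b - a by ring]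
    rw [e]
    convert! h4 using 1
    unfold kg
    have q1 : (t:ℂ) ^ a = (t:ℂ) ^ (a-1) * t := by
      rw [show a = (a - 1) + 1 by ring, Complex.cpow_add _ _ hne, Complex.cpow_one]; ring_nf
    have q2 : ((1+t:ℝ):ℂ) ^ (b-a) = ((1+t:ℝ):ℂ) ^ (b-a-1) * (1 + t) := by
      rw [show b - a = (b - a - 1) + 1 by ring, Complex.cpow_add _ _ hne1, Complex.cpow_one]
      push_cast; ring_nf
    simp only [Pi.mul_apply]
    rw [q1, q2]
    push_cast
    ring
  have hf0 : f 0 = 0 := by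
    simp [hf, kg, ha0]
  have hcont : ContinuousWithinAt f (Ici 0) 0 := by
    apply ContinuousAt.continuousWithinAt
    simp only [hf]
    unfold kg
    rw [show a + 1 - 1 = a by ring]
    apply ContinuousAt.mul
    · apply ContinuousAt.mul
      · fun_prop
      · exact (Complex.continuous_ofReal_cpow_const ha).continuousAt
    · have : ContinuousAt (fun s : ℝ => ((s : ℝ) : ℂ) ^ (b + 1 + 1 - (a+1) - 1)) (1 + 0) :=
        Complex.continuousAt_ofReal_cpow_const _ _ (Or.inr (by norm_num))
      exact ContinuousAt.comp (f := fun t : ℝ => 1 + t) (x := 0) this (by fun_prop)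
  have hlim : Tendsto f atTop (𝓝 0) := by
    obtain ⟨C, hC, hb⟩ := one_add_rpow_le ((b + 1 + 1 - (a+1)).re - 1) (x := x/2) (by linarith)
    have t0 := (tendsto_rpow_mul_exp_neg_mul_atTop_nhds_zero a.re (x/2) (by linarith)).const_mul C
    rw [mul_zero] at t0
    apply squeeze_zero_norm' _ t0
    filter_upwards [eventually_gt_atTop 0] with t ht
    simp only [hf]
    rw [kg_norm _ _ _ ht]
    have e : Real.exp (-(x * t)) = Real.exp (-(x/2)*t) * Real.exp (-(x/2)*t) := by
      rw [← Real.exp_add]; ring_nf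
    have e2 : Real.exp (-(x/2)*t) * Real.exp (x/2*t) = 1 := by
      rw [← Real.exp_add]; simp
    calc _ ≤ Real.exp (-(x * t)) * t ^ ((a+1).re - 1) * (C * Real.exp (x/2*t)) := by
          gcongr
          exact hb t ht.le
      _ = C * (t ^ ((a+1).re - 1) * Real.exp (-(x/2) * t)) * (Real.exp (-(x/2)*t) * Real.exp (x/2*t)) := by
          rw [e]; ring
      _ = _ := by rw [e2, mul_one]; simp
  have main := integral_Ioi_of_hasDerivAt_of_tendsto hcont hD ((i0.add i1).sub i2) hlim
  rw [hf0, integral_sub (f := fun t => a * kg a b x t + (b - x) * kg (a+1) (b+1) x t) (i0.add i1) i2, integral_add i0 i1, integral_const_mul, integral_const_mul,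
    integral_const_mul] at main
  unfold kI
  linear_combination -main

lemma kI_bound {a : ℂ} (b : ℂ) (ha : 0 < a.re) :
    ∃ C : ℝ, ∀ x : ℝ, 1 ≤ x → ‖kI a b x‖ ≤ C := by
  refine ⟨∫ t in Ioi (0:ℝ), ‖kg a b 1 t‖, fun x hx => ?_⟩
  refine norm_integral_le_of_norm_le (kg_int b ha one_pos).norm ?_
  refine (ae_restrict_iff' measurableSet_Ioi).mpr (Eventually.of_forall fun t ht => ?_)
  have ht : 0 < t := ht
  rw [kg_norm _ _ _ ht, kg_norm _ _ _ ht]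
  gcongr

/-- Beta integral on the half line, and limit at zero. -/
lemma beta_Ioi {a b : ℂ} (ha : 0 < a.re) (hb : b.re < 1) :
    IntegrableOn (kg a b 0) (Ioi 0) ∧ kI a b 0 = Gamma a * Gamma (1 - b) / Gamma (a - b + 1) := by
  have hv : 0 < (1 - b).re := by simp; linarith
  set f : ℝ → ℝ := fun t => t / (1 + t)
  set f' : ℝ → ℝ := fun t => 1 / (1 + t)^2
  have hd : ∀ t ∈ Ioi (0:ℝ), HasDerivWithinAt f (f' t) (Ioi 0) t := by
    intro t ht
    have ht : 0 < t := ht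
    have h := (hasDerivAt_id t).div ((hasDerivAt_id t).const_add 1) (by simp; linarith)
    apply HasDerivAt.hasDerivWithinAt
    convert! h using 1
    simp [f']
  have hinj : InjOn f (Ioi 0) := by
    intro s hs t ht h
    have hs : 0 < s := hs
    have ht : 0 < t := ht
    simp only [f] at h
    rw [div_eq_div_iff (by linarith) (by linarith)] at h
    linarith
  have himg : f '' (Ioi 0) = Ioo 0 1 := by
    ext u
    constructor
    · rintro ⟨t, ht, rfl⟩
      have ht : 0 < t := ht
      refine ⟨by simp only [f]; positivity, ?_⟩
      simp only [f]
      rw [div_lt_one (by linarith)]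
      linarith
    · rintro ⟨h0, h1⟩
      have : 0 < 1 - u := by linarith
      refine ⟨u / (1 - u), by simp only [mem_Ioi]; positivity, ?_⟩
      simp only [f]
      field_simp
      ring
  have hconv := Complex.betaIntegral_convergent ha hv
  have hbv := Complex.betaIntegral_eq_Gamma_mul_div a (1-b) ha hv
  rw [Complex.betaIntegral, intervalIntegral.integral_of_le zero_le_one, integral_Ioc_eq_integral_Ioo,
    ← himg, integral_image_eq_integral_abs_deriv_smul measurableSet_Ioi hd hinj] at hbv
  rw [intervalIntegrable_iff_integrableOn_Ioo_of_le zero_le_one, ← himg,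
    integrableOn_image_iff_integrableOn_abs_deriv_smul measurableSet_Ioi hd hinj] at hconv
  have heq : ∀ t ∈ Ioi (0:ℝ), |f' t| • (((f t : ℝ) : ℂ) ^ (a - 1) * (1 - ((f t : ℝ) : ℂ)) ^ (1 - b - 1)) = kg a b 0 t := by
    intro t ht
    have ht : 0 < t := ht
    have h1t : 0 < 1 + t := by linarith
    have hne1 : ((1+t:ℝ):ℂ) ≠ 0 := by exact_mod_cast h1t.ne'
    have e1 : (1 - ((f t : ℝ) : ℂ)) = (((1 + t)⁻¹ : ℝ) : ℂ) := by
      have : 1 - f t = (1 + t)⁻¹ := by simp only [f]; field_simp; ring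
      rw [← this]; simp
    have e2 : |f' t| = ((1+t)^2)⁻¹ := by
      simp only [f']; rw [abs_of_pos (by positivity)]; simp
    have e3 : ((f t : ℝ) : ℂ) ^ (a - 1) = (t:ℂ) ^ (a-1) * (((1+t:ℝ):ℂ) ^ (a-1))⁻¹ := by
      simp only [f]
      rw [div_eq_mul_inv, Complex.ofReal_mul, Complex.mul_cpow_ofReal_nonneg ht.le (by positivity), Complex.ofReal_inv,
        Complex.inv_cpow _ _ (by rw [Complex.arg_ofReal_of_nonneg h1t.le]; exact Real.pi_pos.ne)]
    rw [e1, e2, e3, Complex.ofReal_inv, Complex.inv_cpow _ _ (by rw [Complex.arg_ofReal_of_nonneg h1t.le]; exact Real.pi_pos.ne)]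
    unfold kg
    rw [show b - a - 1 = -(a - 1) + -(1-b-1) + -2 by ring, Complex.cpow_add _ _ hne1, Complex.cpow_add _ _ hne1,
      Complex.cpow_neg, Complex.cpow_neg, Complex.cpow_neg]
    simp
    ring
  refine ⟨hconv.congr_fun heq measurableSet_Ioi, ?_⟩
  unfold kI
  rw [← setIntegral_congr_fun measurableSet_Ioi heq, hbv]
  congr 2
  ring

lemma kI_tendsto_zero {a b : ℂ} (ha : 0 < a.re) (hb : b.re < 1) :
    Tendsto (kI a b) (𝓝[>] 0) (𝓝 (Gamma a * Gamma (1 - b) / Gamma (a - b + 1))) := by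
  obtain ⟨h1, h2⟩ := beta_Ioi ha hb
  rw [← h2]
  refine tendsto_integral_filter_of_dominated_convergence (fun t => ‖kg a b 0 t‖)
    (Eventually.of_forall fun x => kg_meas a b x) ?_ h1.norm ?_
  · filter_upwards [self_mem_nhdsWithin] with x hx
    have hx : 0 < x := hx
    refine (ae_restrict_iff' measurableSet_Ioi).mpr (Eventually.of_forall fun t ht => ?_)
    have ht : 0 < t := ht
    rw [kg_norm _ _ _ ht, kg_norm _ _ _ ht]
    gcongr
  · refine Eventually.of_forall fun t => ?_
    apply Tendsto.mono_left _ nhdsWithin_le_nhds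
    have : Continuous (fun x => kg a b x t) := by unfold kg; fun_prop
    exact this.tendsto 0

lemma kI_tendsto_zero' {a b : ℂ} (ha : 0 < a.re) (hb : 1 < b.re) :
    Tendsto (fun x : ℝ => (x:ℂ) ^ (b - 1) * kI a b x) (𝓝[>] 0) (𝓝 (Gamma (b - 1))) := by
  set G : ℝ → ℝ → ℂ := fun x u => ((Real.exp (-u) : ℝ) : ℂ) * (u:ℂ) ^ (a - 1) * ((x + u : ℝ) : ℂ) ^ (b - a - 1) with hG
  have e : ∀ x ∈ Ioi (0:ℝ), ∫ u in Ioi (0:ℝ), G x u = (x:ℂ) ^ (b - 1) * kI a b x := by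
    intro x hx
    have hx : 0 < x := hx
    have hne : (x:ℂ) ≠ 0 := by exact_mod_cast hx.ne'
    have h := integral_comp_mul_left_Ioi (G x) 0 hx
    rw [mul_zero] at h
    have h' : ∫ u in Ioi (0:ℝ), G x u = x • ∫ t in Ioi (0:ℝ), G x (x * t) := by
      rw [h, smul_smul, mul_inv_cancel₀ hx.ne', one_smul]
    rw [h']
    unfold kI
    rw [← integral_const_mul, ← integral_smul]
    apply setIntegral_congr_fun measurableSet_Ioi
    intro t ht
    have ht : 0 < t := ht
    simp only [hG, kg]
    rw [show x + x * t = x * (1 + t) by ring, Complex.ofReal_mul x t, Complex.ofReal_mul x (1+t),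
      Complex.mul_cpow_ofReal_nonneg hx.le ht.le, Complex.mul_cpow_ofReal_nonneg hx.le (by linarith),
      show b - 1 = (a - 1) + (b - a - 1) + 1 by ring, Complex.cpow_add _ _ hne, Complex.cpow_add _ _ hne,
      Complex.cpow_one, Complex.real_smul]
    ring
  have lim : Tendsto (fun x => ∫ u in Ioi (0:ℝ), G x u) (𝓝[>] 0) (𝓝 (∫ u in Ioi (0:ℝ), G 0 u)) := by
    have hbr : 0 < b.re - 1 := by linarith
    have b1 : IntegrableOn (fun u => ‖kg a b 1 u‖) (Ioi 0) := (kg_int b ha one_pos).norm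
    have b2 := int_real hbr one_pos
    refine tendsto_integral_filter_of_dominated_convergence
      (fun u => ‖kg a b 1 u‖ + Real.exp (-(1*u)) * u ^ (b.re - 1 - 1)) ?_ ?_ (b1.add b2) ?_
    · filter_upwards [self_mem_nhdsWithin] with x hx
      have hx : 0 < x := hx
      apply ContinuousOn.aestronglyMeasurable _ measurableSet_Ioi
      apply ContinuousOn.mul
      · apply ContinuousOn.mul
        · fun_prop
        · intro t ht
          apply ContinuousAt.continuousWithinAt
          exact Complex.continuousAt_ofReal_cpow_const _ _ (Or.inr (ne_of_gt ht))
      · intro t ht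
        apply ContinuousAt.continuousWithinAt
        have : ContinuousAt (fun s : ℝ => ((s : ℝ) : ℂ) ^ (b - a - 1)) (x + t) :=
          Complex.continuousAt_ofReal_cpow_const _ _ (Or.inr (by have : 0 < t := ht; linarith))
        exact ContinuousAt.comp (f := fun t : ℝ => x + t) (x := t) this (by fun_prop)
    · have : Ioc (0:ℝ) 1 ∈ 𝓝[>] (0:ℝ) := Ioc_mem_nhdsGT one_pos
      filter_upwards [this] with x hx
      obtain ⟨hx0, hx1⟩ := hx
      refine (ae_restrict_iff' measurableSet_Ioi).mpr (Eventually.of_forall fun t ht => ?_)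
      have ht : 0 < t := ht
      rw [kg_norm _ _ _ ht]
      have hn : ‖G x t‖ = Real.exp (-(1*t)) * t ^ (a.re - 1) * (x + t) ^ ((b - a).re - 1) := by
        simp only [hG]
        rw [norm_mul, norm_mul, Complex.norm_real, Complex.norm_cpow_eq_rpow_re_of_pos ht,
          Complex.norm_cpow_eq_rpow_re_of_pos (by linarith), Real.norm_of_nonneg (Real.exp_pos _).le]
        simp
      rw [hn]
      by_cases hc : 0 ≤ (b-a).re - 1
      · have : (x + t) ^ ((b - a).re - 1) ≤ (1 + t) ^ ((b - a).re - 1) :=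
          Real.rpow_le_rpow (by linarith) (by linarith) hc
        have h2 : 0 ≤ Real.exp (-(1*t)) * t ^ (b.re - 1 - 1) := by positivity
        have h3 : Real.exp (-(1*t)) * t ^ (a.re - 1) * (x + t) ^ ((b - a).re - 1) ≤ Real.exp (-(1*t)) * t ^ (a.re - 1) * (1 + t) ^ ((b - a).re - 1) := by gcongr
        linarith
      · have : (x + t) ^ ((b - a).re - 1) ≤ t ^ ((b - a).re - 1) :=
          Real.rpow_le_rpow_of_nonpos ht (by linarith) (by linarith)
        have h2 : 0 ≤ Real.exp (-(1*t)) * t ^ (a.re - 1) * (1 + t) ^ ((b - a).re - 1) := by positivity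
        have h3 : Real.exp (-(1*t)) * t ^ (a.re - 1) * (x + t) ^ ((b - a).re - 1) ≤ Real.exp (-(1*t)) * t ^ (a.re - 1) * t ^ ((b - a).re - 1) := by gcongr
        have h4 : t ^ (a.re - 1) * t ^ ((b - a).re - 1) = t ^ (b.re - 1 - 1) := by
          rw [← Real.rpow_add ht]
          congr 1
          simp; ring
        rw [mul_assoc _ (t ^ (a.re - 1)) (t ^ ((b - a).re - 1)), h4] at h3
        linarith
    · refine (ae_restrict_iff' measurableSet_Ioi).mpr (Eventually.of_forall fun t ht => ?_)
      apply Tendsto.mono_left _ nhdsWithin_le_nhds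
      have ht : 0 < t := ht
      have : ContinuousAt (fun s : ℝ => ((s : ℝ) : ℂ) ^ (b - a - 1)) (0 + t) :=
          Complex.continuousAt_ofReal_cpow_const _ _ (Or.inr (by linarith))
      have h2 := ContinuousAt.comp (f := fun x : ℝ => x + t) (x := 0) this (by fun_prop)
      exact (h2.tendsto).const_mul _
  have eG : ∫ u in Ioi (0:ℝ), G 0 u = Gamma (b - 1) := by
    rw [Complex.Gamma_eq_integral (by simp; linarith), Complex.GammaIntegral]
    apply setIntegral_congr_fun measurableSet_Ioi
    intro t ht
    have ht : 0 < t := ht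
    have hne : (t:ℂ) ≠ 0 := by exact_mod_cast ht.ne'
    simp only [hG]
    rw [zero_add, mul_assoc, ← Complex.cpow_add _ _ hne]
    ring_nf
  rw [eG] at lim
  refine lim.congr' ?_
  filter_upwards [self_mem_nhdsWithin] with x hx using e x hx

/-! ### Solutions of the Kummer equation -/

def KSol (a b : ℂ) (f f1 : ℝ → ℂ) : Prop :=
  ∀ x : ℝ, 0 < x → HasDerivAt f (f1 x) x ∧ HasDerivAt f1 ((a * f x + (x - b) * f1 x) / x) x

lemma cpow_deriv (s : ℂ) {x : ℝ} (hx : 0 < x) :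
    HasDerivAt (fun x : ℝ => (x:ℂ) ^ s) (s * (x:ℂ) ^ (s - 1)) x := by
  have := ((hasDerivAt_id (x:ℂ)).cpow_const (c := s) (Or.inl (by simpa using hx))).comp_ofReal
  simpa using this

noncomputable def kS (a b : ℂ) (x : ℝ) : ℂ := (x:ℂ) ^ (1 - b) * kK (a - b + 1) (2 - b) x

lemma kS_shift (a b : ℂ) (x : ℝ) : kS (a+1) (b+1) x = (x:ℂ) ^ (-b) * kK (a - b + 1) (1 - b) x := by
  unfold kS
  congr 2 <;> ring

lemma kK_real_deriv (a : ℂ) {b : ℂ} (hb : b.im ≠ 0) (x : ℝ) :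
    HasDerivAt (fun x : ℝ => kK a b x) ((a / b) * kK (a+1) (b+1) x) x :=
  (kK_hasDerivAt a hb x).comp_ofReal

lemma kK_cont (a : ℂ) {b : ℂ} (hb : b.im ≠ 0) : Continuous (fun x : ℝ => kK a b x) :=
  continuous_iff_continuousAt.mpr fun x => (kK_real_deriv a hb x).continuousAt

lemma kS_deriv (a : ℂ) {b : ℂ} (hb : b.im ≠ 0) {x : ℝ} (hx : 0 < x) :
    HasDerivAt (kS a b) ((1 - b) * kS (a+1) (b+1) x) x := by
  have hne : (x:ℂ) ≠ 0 := by exact_mod_cast hx.ne'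
  have h2b : (2 - b).im ≠ 0 := by simpa using hb
  have h1b : (1 - b).im ≠ 0 := by simpa using hb
  have h := (cpow_deriv (1 - b) hx).mul (kK_real_deriv (a - b + 1) h2b x)
  convert! h using 1
  rw [kS_shift]
  have e := kK_bshift (a - b + 1) h1b (x:ℂ)
  rw [show 1 - b + 1 = 2 - b by ring] at e
  rw [show 1 - b - 1 = -b by ring, show (1 - b) = -b + 1 by ring, Complex.cpow_add _ _ hne, Complex.cpow_one,
    show -b + 1 = 1 - b by ring]
  linear_combination -(x:ℂ) ^ (-b) * e

lemma KSol_K (a : ℂ) {b : ℂ} (hb : b.im ≠ 0) :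
    KSol a b (fun x => kK a b x) (fun x => (a / b) * kK (a+1) (b+1) x) := by
  intro x hx
  have hne : (x:ℂ) ≠ 0 := by exact_mod_cast hx.ne'
  have hb1 : (b+1).im ≠ 0 := by simpa using hb
  refine ⟨kK_real_deriv a hb x, ?_⟩
  convert! (kK_real_deriv (a+1) hb1 x).const_mul (a/b) using 1
  rw [div_eq_iff hne]
  linear_combination - kK_ode a hb (x:ℂ)

lemma KSol_transfer {a b : ℂ} {f f1 : ℝ → ℂ} (h : KSol (a - b + 1) (2 - b) f f1) :
    KSol a b (fun x => (x:ℂ) ^ (1 - b) * f x)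
      (fun x => (1 - b) * (x:ℂ) ^ (-b) * f x + (x:ℂ) ^ (1 - b) * f1 x) := by
  intro x hx
  have hne : (x:ℂ) ≠ 0 := by exact_mod_cast hx.ne'
  obtain ⟨h1, h2⟩ := h x hx
  have c1 := cpow_deriv (1 - b) hx
  have c0 := cpow_deriv (-b) hx
  rw [show 1 - b - 1 = -b by ring] at c1
  constructor
  · exact c1.mul h1
  · have := ((c0.const_mul (1-b)).mul h1).add (c1.mul h2)
    convert! this using 1
    have p1 : (x:ℂ) ^ (-b) = (x:ℂ) ^ (-b-1) * x := by
      conv_lhs => rw [show -b = (-b-1) + 1 by ring, Complex.cpow_add _ _ hne, Complex.cpow_one]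
    have p2 : (x:ℂ) ^ (1-b) = (x:ℂ) ^ (-b-1) * x * x := by
      conv_lhs => rw [show 1-b = (-b-1) + 1 + 1 by ring, Complex.cpow_add _ _ hne, Complex.cpow_add _ _ hne, Complex.cpow_one]
    simp only []
    rw [p2, p1]
    field_simp
    ring

lemma KSol_congr {a b : ℂ} {f f1 g1 : ℝ → ℂ} (h : KSol a b f f1) (h' : ∀ x : ℝ, 0 < x → HasDerivAt f (g1 x) x) :
    KSol a b f g1 := by
  have e : ∀ x : ℝ, 0 < x → f1 x = g1 x := fun x hx => (h x hx).1.unique (h' x hx)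
  intro x hx
  refine ⟨h' x hx, ?_⟩
  rw [← e x hx]
  refine (h x hx).2.congr_of_eventuallyEq ?_
  filter_upwards [Ioi_mem_nhds hx] with y hy
  exact (e y hy).symm

lemma KSol_S (a : ℂ) {b : ℂ} (hb : b.im ≠ 0) :
    KSol a b (kS a b) (fun x => (1 - b) * kS (a+1) (b+1) x) := by
  have h2b : (2 - b).im ≠ 0 := by simpa using hb
  exact KSol_congr (KSol_transfer (KSol_K (a - b + 1) h2b)) (fun x hx => kS_deriv a hb hx)

lemma KSol_I {a : ℂ} (b : ℂ) (ha : 0 < a.re) :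
    KSol a b (kI a b) (fun x => - kI (a+1) (b+1) x) := by
  intro x hx
  have hne : (x:ℂ) ≠ 0 := by exact_mod_cast hx.ne'
  have ha1 : 0 < (a+1).re := by simp; linarith
  refine ⟨kI_hasDerivAt b ha hx, ?_⟩
  convert! (kI_hasDerivAt (b+1) ha1 hx).neg using 1
  rw [div_eq_iff hne]
  linear_combination - kI_ode b ha hx

lemma KSol_lin {a b c d : ℂ} {f f1 g g1 : ℝ → ℂ} (hf : KSol a b f f1) (hg : KSol a b g g1) :
    KSol a b (fun x => c * f x + d * g x) (fun x => c * f1 x + d * g1 x) := by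
  intro x hx
  refine ⟨((hf x hx).1.const_mul c).add ((hg x hx).1.const_mul d), ?_⟩
  convert! ((hf x hx).2.const_mul c).add ((hg x hx).2.const_mul d) using 1
  ring

/-- normalized Wronskian -/
noncomputable def wr (b : ℂ) (f f1 g g1 : ℝ → ℂ) (x : ℝ) : ℂ :=
  (x:ℂ) ^ b * Complex.exp (-(x:ℂ)) * (f x * g1 x - f1 x * g x)

lemma wr_const {a b : ℂ} {f f1 g g1 : ℝ → ℂ} (hf : KSol a b f f1) (hg : KSol a b g g1) :
    ∃ c : ℂ, ∀ x : ℝ, 0 < x → wr b f f1 g g1 x = c := by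
  have hd : ∀ x ∈ Ioi (0:ℝ), HasDerivAt (wr b f f1 g g1) 0 x := by
    intro x hx
    have hx : 0 < x := hx
    have hne : (x:ℂ) ≠ 0 := by exact_mod_cast hx.ne'
    have he : HasDerivAt (fun x : ℝ => Complex.exp (-(x:ℂ))) (Complex.exp (-(x:ℂ)) * (-1)) x :=
      ((hasDerivAt_id (x:ℂ)).neg.cexp).comp_ofReal
    have := ((cpow_deriv b hx).mul he).mul
      (((hf x hx).1.mul (hg x hx).2).sub ((hf x hx).2.mul (hg x hx).1))
    convert! this using 1
    have p1 : (x:ℂ) ^ b = (x:ℂ) ^ (b-1) * x := by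
      conv_lhs => rw [show b = (b-1) + 1 by ring, Complex.cpow_add _ _ hne, Complex.cpow_one]
    simp only [Pi.mul_apply, Pi.sub_apply]
    rw [p1]
    field_simp
    ring
  obtain ⟨c, hc⟩ := isOpen_Ioi.exists_is_const_of_deriv_eq_zero isPreconnected_Ioi
    (fun x hx => (hd x hx).differentiableAt.differentiableWithinAt) (fun x hx => (hd x hx).deriv)
  exact ⟨c, fun x hx => hc x hx⟩

lemma wr_KS (a : ℂ) {b : ℂ} (hb : b.im ≠ 0) {x : ℝ} (hx : 0 < x) :
    wr b (fun x => kK a b x) (fun x => (a / b) * kK (a+1) (b+1) x) (kS a b)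
      (fun x => (1 - b) * kS (a+1) (b+1) x) x = 1 - b := by
  have hb1 : (b+1).im ≠ 0 := by simpa using hb
  have h2b : (2 - b).im ≠ 0 := by simpa using hb
  have h1b : (1 - b).im ≠ 0 := by simpa using hb
  obtain ⟨c, hc⟩ := wr_const (KSol_K a hb) (KSol_S a hb)
  rw [hc x hx]
  set Φ : ℝ → ℂ := fun x => Complex.exp (-(x:ℂ)) * ((1 - b) * kK a b x * kK (a - b + 1) (1 - b) x
    - x * ((a / b) * kK (a+1) (b+1) x) * kK (a - b + 1) (2 - b) x) with hΦ
  have hcont : Continuous Φ := by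
    have c1 := kK_cont a hb
    have c2 := kK_cont (a+1) hb1
    have c3 := kK_cont (a-b+1) h1b
    have c4 := kK_cont (a-b+1) h2b
    fun_prop
  have hlim : Tendsto Φ (𝓝[>] 0) (𝓝 (Φ 0)) := (hcont.tendsto 0).mono_left nhdsWithin_le_nhds
  have h0 : Φ 0 = 1 - b := by simp [hΦ, kK_zero]
  rw [h0] at hlim
  refine tendsto_nhds_unique (Tendsto.congr' ?_ (tendsto_const_nhds (x := c) (f := 𝓝[>] (0:ℝ)))) hlim
  filter_upwards [self_mem_nhdsWithin] with y hy
  have hy : 0 < y := hy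
  have hne : (y:ℂ) ≠ 0 := by exact_mod_cast hy.ne'
  rw [← hc y hy, wr, kS_shift, kS, hΦ]
  have p1 : (y:ℂ) ^ b * (y:ℂ) ^ (-b) = 1 := by
    rw [← Complex.cpow_add _ _ hne]; simp
  have p2 : (y:ℂ) ^ b * (y:ℂ) ^ (1-b) = y := by
    rw [← Complex.cpow_add _ _ hne]; simp
  linear_combination (Complex.exp (-(y:ℂ)) * ((1 - b) * kK a b y * kK (a - b + 1) (1 - b) y)) * p1 -
    Complex.exp (-(y:ℂ)) * (((a / b) * kK (a+1) (b+1) y) * kK (a - b + 1) (2 - b) y) * p2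

lemma sub_ne {b : ℂ} (hb : b.im ≠ 0) : 1 - b ≠ 0 := by
  intro h
  have := congrArg Complex.im h
  simp at this
  exact hb this

lemma KSol_span {a b : ℂ} (hb : b.im ≠ 0) {f f1 : ℝ → ℂ} (hf : KSol a b f f1) :
    ∃ C1 C2 : ℂ, ∀ x : ℝ, 0 < x → f x = C1 * kK a b x + C2 * kS a b x := by
  obtain ⟨c, hc⟩ := wr_const hf (KSol_S a hb)
  obtain ⟨d, hd⟩ := wr_const hf (KSol_K a hb)
  refine ⟨c / (1 - b), - d / (1 - b), fun x hx => ?_⟩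
  have h1 := hc x hx
  have h2 := hd x hx
  have h3 := wr_KS a hb hx
  have hne := sub_ne hb
  apply mul_left_cancel₀ hne
  have : (1 - b) * (c / (1 - b) * kK a b x + - d / (1 - b) * kS a b x) = c * kK a b x - d * kS a b x := by
    field_simp
    ring
  rw [this]
  unfold wr at h1 h2 h3
  linear_combination -(f x) * h3 + kK a b x * h1 - kS a b x * h2

lemma cpow_tendsto_zero {s : ℂ} (hs : 0 < s.re) : Tendsto (fun x : ℝ => (x:ℂ) ^ s) (𝓝[>] 0) (𝓝 0) := by
  have := (Complex.continuous_ofReal_cpow_const hs).tendsto 0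
  have hs0 : s ≠ 0 := by intro h; simp [h] at hs
  simp only [Complex.ofReal_zero, Complex.zero_cpow hs0] at this
  exact this.mono_left nhdsWithin_le_nhds

lemma kK_tendsto (a : ℂ) {b : ℂ} (hb : b.im ≠ 0) : Tendsto (fun x : ℝ => kK a b x) (𝓝[>] 0) (𝓝 1) := by
  have := (kK_cont a hb).tendsto 0
  simp only [Complex.ofReal_zero, kK_zero] at this
  exact this.mono_left nhdsWithin_le_nhds

lemma kI_C1 {a b : ℂ} (ha : 0 < a.re) (hbi : b.im ≠ 0) (hb : b.re < 1) {C1 C2 : ℂ}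
    (h : ∀ x : ℝ, 0 < x → kI a b x = C1 * kK a b x + C2 * kS a b x) :
    C1 = Gamma a * Gamma (1 - b) / Gamma (a - b + 1) := by
  have h2b : (2 - b).im ≠ 0 := by simpa using hbi
  have l1 := kI_tendsto_zero ha hb
  have l2 := ((kK_tendsto a hbi).const_mul C1).add
    (((cpow_tendsto_zero (s := 1 - b) (by simp; linarith)).mul (kK_tendsto (a-b+1) h2b)).const_mul C2)
  simp only [mul_one, mul_zero, add_zero] at l2
  refine tendsto_nhds_unique l2 (l1.congr' ?_)
  filter_upwards [self_mem_nhdsWithin] with x hx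
  exact h x hx

lemma kI_C2 (n : ℕ) : ∀ {a b : ℂ} (_ : 0 < a.re) (_ : b.im ≠ 0) (_ : 1 < b.re + n) {C1 C2 : ℂ}
    (_ : ∀ x : ℝ, 0 < x → kI a b x = C1 * kK a b x + C2 * kS a b x), C2 = Gamma (b - 1) := by
  induction n with
  | zero =>
    intro a b ha hbi hb C1 C2 h
    have h2b : (2 - b).im ≠ 0 := by simpa using hbi
    have hb : 1 < b.re := by simpa using hb
    have l1 := kI_tendsto_zero' ha hb
    have l2 := (((cpow_tendsto_zero (s := b - 1) (by simp; linarith)).mul (kK_tendsto a hbi)).const_mul C1).add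
      ((kK_tendsto (a-b+1) h2b).const_mul C2)
    simp only [mul_one, mul_zero, zero_add] at l2
    refine tendsto_nhds_unique l2 (l1.congr' ?_)
    filter_upwards [self_mem_nhdsWithin] with x hx
    have hx : 0 < x := hx
    have hne : (x:ℂ) ≠ 0 := by exact_mod_cast hx.ne'
    rw [h x hx, kS]
    have p1 : (x:ℂ) ^ (b-1) * (x:ℂ) ^ (1-b) = 1 := by
      rw [← Complex.cpow_add _ _ hne]; simp
    linear_combination C2 * kK (a - b + 1) (2 - b) x * p1
  | succ n ih =>
    intro a b ha hbi hb C1 C2 h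
    have hb1 : (b+1).im ≠ 0 := by simpa using hbi
    have ha1 : 0 < (a+1).re := by simp; linarith
    have hd : ∀ x : ℝ, 0 < x → kI (a+1) (b+1) x
        = (-(C1 * (a / b))) * kK (a+1) (b+1) x + (C2 * (b - 1)) * kS (a+1) (b+1) x := by
      intro x hx
      have h1 := kI_hasDerivAt b ha hx
      have h2 := ((kK_real_deriv a hbi x).const_mul C1).add ((kS_deriv a hbi hx).const_mul C2)
      have h3 : HasDerivAt (kI a b) (C1 * ((a / b) * kK (a+1) (b+1) x) + C2 * ((1 - b) * kS (a+1) (b+1) x)) x := by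
        refine h2.congr_of_eventuallyEq ?_
        filter_upwards [Ioi_mem_nhds hx] with y hy
        exact h y hy
      have := h1.unique h3
      linear_combination - this
    have := ih ha1 hb1 (by push_cast at hb; simp; linarith) hd
    have hne : b - 1 ≠ 0 := by rw [← neg_sub]; exact neg_ne_zero.mpr (sub_ne hbi)
    rw [show b + 1 - 1 = (b - 1) + 1 by ring, Complex.Gamma_add_one _ hne] at this
    apply mul_left_cancel₀ hne
    linear_combination this

/-- Tricomi function -/
noncomputable def kV (a b : ℂ) (x : ℝ) : ℂ :=
  Gamma (1 - b) / Gamma (a - b + 1) * kK a b x + Gamma (b - 1) / Gamma a * kS a b x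

lemma kV_eq_kI {a b : ℂ} (ha : 0 < a.re) (hbi : b.im ≠ 0) (hb : b.re < 1) {x : ℝ} (hx : 0 < x) :
    kV a b x = kI a b x / Gamma a := by
  obtain ⟨C1, C2, h⟩ := KSol_span hbi (KSol_I b ha)
  obtain ⟨n, hn⟩ := exists_nat_gt (1 - b.re)
  have e1 := kI_C1 ha hbi hb h
  have e2 := kI_C2 n ha hbi (by linarith) h
  have hG := Complex.Gamma_ne_zero_of_re_pos ha
  rw [h x hx, e1, e2, kV]
  field_simp

lemma ne_zero_of_im {b : ℂ} (hb : b.im ≠ 0) : b ≠ 0 := by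
  intro h; simp [h] at hb

lemma KSol_V {a b : ℂ} (hai : a.im ≠ 0) (hb : b.im ≠ 0) :
    KSol a b (kV a b) (fun x => -a * kV (a+1) (b+1) x) := by
  have h := KSol_lin (c := Gamma (1 - b) / Gamma (a - b + 1)) (d := Gamma (b - 1) / Gamma a)
    (KSol_K a hb) (KSol_S a hb)
  have e : (fun x : ℝ => -a * kV (a+1) (b+1) x) = fun x : ℝ => Gamma (1 - b) / Gamma (a - b + 1) *
      ((a / b) * kK (a+1) (b+1) x) + Gamma (b - 1) / Gamma a * ((1 - b) * kS (a+1) (b+1) x) := by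
    funext x
    unfold kV
    have hb0 := ne_zero_of_im hb
    have ha0 := ne_zero_of_im hai
    have hne : b - 1 ≠ 0 := by rw [← neg_sub]; exact neg_ne_zero.mpr (sub_ne hb)
    have g1 : Gamma (1 - b) = -b * Gamma (-b) := by
      rw [← Complex.Gamma_add_one _ (neg_ne_zero.mpr hb0)]; ring_nf
    have g2 : Gamma (b + 1 - 1) = (b - 1) * Gamma (b - 1) := by
      rw [← Complex.Gamma_add_one _ hne]; ring_nf
    rw [Complex.Gamma_add_one _ ha0, g1, g2, show 1 - (b+1) = -b by ring, show a + 1 - (b+1) + 1 = a - b + 1 by ring]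
    by_cases hz : Gamma a = 0
    · rw [hz]; simp; field_simp
    · by_cases hz2 : Gamma (a - b + 1) = 0
      · rw [hz2]; simp; field_simp; ring
      · field_simp
        ring
  rw [e]
  exact h

lemma kV_swap (a b : ℂ) {x : ℝ} (hx : 0 < x) : kV a b x = (x:ℂ) ^ (1 - b) * kV (a - b + 1) (2 - b) x := by
  have hne : (x:ℂ) ≠ 0 := by exact_mod_cast hx.ne'
  unfold kV kS
  have p1 : (x:ℂ) ^ (1-b) * (x:ℂ) ^ (1-(2-b)) = 1 := by
    rw [← Complex.cpow_add _ _ hne]; ring_nf; simp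
  rw [show 1 - (2 - b) = b - 1 by ring] at *
  rw [show a - b + 1 - (2-b) + 1 = a by ring, show 2 - b - 1 = 1 - b by ring, show 2 - (2 - b) = b by ring]
  linear_combination - (Gamma (1 - b) / Gamma (a - b + 1) * kK a b x) * p1

/-! ### Polynomial growth -/

def PG (f : ℝ → ℂ) : Prop := ∃ N : ℕ, f =O[atTop] (fun x : ℝ => x ^ N)

lemma PG.mul {f g : ℝ → ℂ} (hf : PG f) (hg : PG g) : PG (fun x => f x * g x) := by
  obtain ⟨N, h⟩ := hf
  obtain ⟨M, h'⟩ := hg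
  refine ⟨N + M, ?_⟩
  simp only [pow_add]
  exact h.mul h'

lemma pow_mono_O {N M : ℕ} (h : N ≤ M) : (fun x : ℝ => x ^ N) =O[atTop] (fun x : ℝ => x ^ M) := by
  apply Asymptotics.IsBigO.of_bound 1
  filter_upwards [eventually_ge_atTop 1] with x hx
  rw [Real.norm_of_nonneg (by positivity), Real.norm_of_nonneg (by positivity), one_mul]
  exact pow_le_pow_right₀ hx h

lemma PG.add {f g : ℝ → ℂ} (hf : PG f) (hg : PG g) : PG (fun x => f x + g x) := by
  obtain ⟨N, h⟩ := hf
  obtain ⟨M, h'⟩ := hg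
  exact ⟨max N M, (h.trans (pow_mono_O (le_max_left _ _))).add (h'.trans (pow_mono_O (le_max_right _ _)))⟩

lemma PG.const (c : ℂ) : PG (fun _ => c) := by
  refine ⟨0, ?_⟩
  simp only [pow_zero]
  exact Asymptotics.isBigO_const_const _ one_ne_zero _

lemma PG.cpow (s : ℂ) : PG (fun x => (x:ℂ) ^ s) := by
  obtain ⟨n, hn⟩ := exists_nat_gt s.re
  refine ⟨n, ?_⟩
  apply Asymptotics.IsBigO.of_bound 1
  filter_upwards [eventually_ge_atTop 1] with x hx
  rw [Complex.norm_cpow_eq_rpow_re_of_pos (by linarith), Real.norm_of_nonneg (by positivity), one_mul,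
    ← Real.rpow_natCast]
  exact Real.rpow_le_rpow_of_exponent_le hx hn.le

lemma PG.id : PG (fun x => (x:ℂ)) := by
  have := PG.cpow 1
  simpa using this

lemma PG.congr {f g : ℝ → ℂ} (hf : PG f) (h : ∀ x : ℝ, 0 < x → f x = g x) : PG g := by
  obtain ⟨N, hN⟩ := hf
  refine ⟨N, hN.congr' ?_ EventuallyEq.rfl⟩
  filter_upwards [eventually_gt_atTop 0] with x hx using h x hx

def GG (a b : ℂ) : Prop := PG (kV a b) ∧ PG (kV (a+1) (b+1))

lemma GG_base {a b : ℂ} (ha : 0 < a.re) (hai : a.im ≠ 0) (hbi : b.im ≠ 0) (hb : b.re < 1) : GG a b := by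
  have ha1 : 0 < (a+1).re := by simp; linarith
  have key : ∀ {a b : ℂ}, 0 < a.re → PG (kI a b) := by
    intro a b ha
    obtain ⟨C, hC⟩ := kI_bound b ha
    refine ⟨0, ?_⟩
    apply Asymptotics.IsBigO.of_bound C
    filter_upwards [eventually_ge_atTop 1] with x hx
    simpa using hC x hx
  constructor
  · refine ((PG.const (Gamma a)⁻¹).mul (key ha (b := b))).congr fun x hx => ?_
    rw [kV_eq_kI ha hbi hb hx]; ring
  · refine ((PG.const ((Gamma a)⁻¹ * a⁻¹)).mul (key ha1 (b := b+1))).congr fun x hx => ?_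
    have h1 := (KSol_V hai hbi x hx).1
    have h2 := (kI_hasDerivAt b ha hx).div_const (Gamma a)
    have h3 : HasDerivAt (kV a b) (-kI (a+1) (b+1) x / Gamma a) x := by
      refine h2.congr_of_eventuallyEq ?_
      filter_upwards [Ioi_mem_nhds hx] with y hy
      exact kV_eq_kI ha hbi hb hy
    have h4 := h1.unique h3
    have ha0 := ne_zero_of_im hai
    apply mul_left_cancel₀ ha0
    have : a * kV (a+1) (b+1) x = kI (a+1) (b+1) x / Gamma a := by linear_combination -h4
    rw [this]
    field_simp

lemma GG_step {a b : ℂ} (hai : a.im ≠ 0) (hbi : b.im ≠ 0) (h : GG (a+1) (b+1)) : GG a b := by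
  have hb1 : (b+1).im ≠ 0 := by simpa using hbi
  have ha1 : (a+1).im ≠ 0 := by simpa using hai
  refine ⟨?_, h.1⟩
  have := ((PG.id.mul (PG.const (a+1))).mul h.2).add (((PG.const (-b)).add PG.id).mul h.1)
  refine this.congr fun x hx => ?_
  have hne : (x:ℂ) ≠ 0 := by exact_mod_cast hx.ne'
  have ha0 := ne_zero_of_im hai
  have h1 := (KSol_V hai hbi x hx).2
  have h2 := ((KSol_V ha1 hb1 x hx).1).const_mul (-a)
  have h3 := h1.unique h2
  rw [div_eq_iff hne] at h3
  apply mul_left_cancel₀ ha0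
  linear_combination -h3

lemma GG_swap {a b : ℂ} (hai : a.im ≠ 0) (hbi : b.im ≠ 0) (hi : (a - b + 1).im ≠ 0)
    (h : GG (a - b + 1) (2 - b)) : GG a b := by
  have h2b : (2 - b).im ≠ 0 := by simpa using hbi
  refine ⟨((PG.cpow (1-b)).mul h.1).congr fun x hx => (kV_swap a b hx).symm, ?_⟩
  have := (((PG.const (-a⁻¹ * (1 - b))).mul (PG.cpow (-b))).mul h.1).add
    (((PG.const (a⁻¹ * (a - b + 1))).mul (PG.cpow (1-b))).mul h.2)
  refine this.congr fun x hx => ?_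
  have ha0 := ne_zero_of_im hai
  have h1 := (KSol_V hai hbi x hx).1
  have h2 := (cpow_deriv (1-b) hx).mul (KSol_V hi h2b x hx).1
  rw [show 1 - b - 1 = -b by ring] at h2
  have h3 : HasDerivAt (kV a b) ((1 - b) * (x:ℂ) ^ (-b) * kV (a - b + 1) (2 - b) x
      + (x:ℂ) ^ (1 - b) * (-(a - b + 1) * kV (a - b + 1 + 1) (2 - b + 1) x)) x := by
    refine h2.congr_of_eventuallyEq ?_
    filter_upwards [Ioi_mem_nhds hx] with y hy
    exact kV_swap a b hy
  have h4 := h1.unique h3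
  apply mul_left_cancel₀ ha0
  field_simp
  linear_combination h4

lemma GG_down {a b : ℂ} (hai : a.im ≠ 0) (hbi : b.im ≠ 0) (hi : (a - b + 1).im ≠ 0)
    (h : GG a (b - 1)) : GG a b := by
  have h2b : (2 - b).im ≠ 0 := by simpa using hbi
  apply GG_swap hai hbi hi
  apply GG_step hi h2b
  apply GG_swap
  · simpa using hi
  · simpa using hbi
  · simpa using hai
  · convert h using 1 <;> ring

lemma GG_all {a b : ℂ} (hai : a.im ≠ 0) (hbi : b.im ≠ 0) (hi : (a - b + 1).im ≠ 0) : GG a b := by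
  have s1 : ∀ n : ℕ, ∀ a b : ℂ, a.im ≠ 0 → b.im ≠ 0 → (a - b + 1).im ≠ 0 → 0 < a.re → b.re < 1 + n → GG a b := by
    intro n
    induction n with
    | zero => intro a b h1 h2 h3 h4 h5; exact GG_base h4 h1 h2 (by simpa using h5)
    | succ n ih =>
      intro a b h1 h2 h3 h4 h5
      apply GG_down h1 h2 h3
      apply ih _ _ h1 (by simpa using h2) (by simpa using h3) h4
      push_cast at h5
      simp
      linarith
  have s2 : ∀ n : ℕ, ∀ a b : ℂ, a.im ≠ 0 → b.im ≠ 0 → (a - b + 1).im ≠ 0 → 0 < a.re + n → GG a b := by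
    intro n
    induction n with
    | zero =>
      intro a b h1 h2 h3 h4
      obtain ⟨m, hm⟩ := exists_nat_gt (b.re - 1)
      exact s1 m a b h1 h2 h3 (by simpa using h4) (by linarith)
    | succ n ih =>
      intro a b h1 h2 h3 h4
      apply GG_step h1 h2
      apply ih _ _ (by simpa using h1) (by simpa using h2) (by simpa using h3)
      push_cast at h4
      simp
      linarith
  obtain ⟨n, hn⟩ := exists_nat_gt (-a.re)
  exact s2 n a b hai hbi hi (by linarith)

/-! ### The energy argument -/

lemma energy {y y1 q : ℝ → ℂ} {x₀ d : ℝ} (hx : 0 < x₀) (hd : d ≠ 0)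
    (h1 : ∀ x : ℝ, 0 < x → HasDerivAt y (y1 x) x) (h2 : ∀ x : ℝ, 0 < x → HasDerivAt y1 (q x * y x) x)
    (hq : ∀ x : ℝ, 0 < x → (q x).im = d / x ^ 2)
    (ly : Tendsto y atTop (𝓝 0)) (ly1 : Tendsto y1 atTop (𝓝 0)) (h0 : y x₀ = 0) :
    ∀ x : ℝ, x₀ < x → y x = 0 := by
  set h : ℝ → ℝ := fun x => d * ((y x).re * (y1 x).im - (y x).im * (y1 x).re) with hh
  have hre : ∀ {f : ℝ → ℂ} {f' : ℂ} {x : ℝ}, HasDerivAt f f' x → HasDerivAt (fun x => (f x).re) f'.re x :=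
    fun hf => Complex.reCLM.hasFDerivAt.comp_hasDerivAt _ hf
  have him : ∀ {f : ℝ → ℂ} {f' : ℂ} {x : ℝ}, HasDerivAt f f' x → HasDerivAt (fun x => (f x).im) f'.im x :=
    fun hf => Complex.imCLM.hasFDerivAt.comp_hasDerivAt _ hf
  have hder : ∀ x : ℝ, 0 < x → HasDerivAt h (d ^ 2 * ((y x).re ^ 2 + (y x).im ^ 2) / x ^ 2) x := by
    intro x hx
    have := (((hre (h1 x hx)).mul (him (h2 x hx))).sub ((him (h1 x hx)).mul (hre (h2 x hx)))).const_mul d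
    convert! this using 1
    rw [Complex.mul_im, Complex.mul_re, hq x hx]
    ring
  have hmono : MonotoneOn h (Ici x₀) := by
    apply monotoneOn_of_deriv_nonneg (convex_Ici x₀)
    · intro x hx'
      exact (hder x (lt_of_lt_of_le hx hx')).continuousAt.continuousWithinAt
    · intro x hx'
      rw [interior_Ici] at hx'
      exact (hder x (lt_trans hx hx')).differentiableAt.differentiableWithinAt
    · intro x hx'
      rw [interior_Ici] at hx'
      rw [(hder x (lt_trans hx hx')).deriv]
      positivity
  have hx0 : h x₀ = 0 := by simp [hh, h0]
  have hlim : Tendsto h atTop (𝓝 0) := by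
    have a1 := (Complex.continuous_re.tendsto 0).comp ly
    have a2 := (Complex.continuous_im.tendsto 0).comp ly
    have a3 := (Complex.continuous_re.tendsto 0).comp ly1
    have a4 := (Complex.continuous_im.tendsto 0).comp ly1
    have := ((a1.mul a4).sub (a2.mul a3)).const_mul d
    simpa using this
  have hz : ∀ x ∈ Ici x₀, h x = 0 := by
    intro x hx'
    apply le_antisymm
    · apply ge_of_tendsto hlim
      filter_upwards [eventually_ge_atTop x] with z hz
      exact hmono hx' (le_trans hx' hz) hz
    · rw [← hx0]
      exact hmono self_mem_Ici hx' hx'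
  intro x hx'
  have hxp : 0 < x := lt_trans hx hx'
  have e : HasDerivAt h 0 x := by
    refine (hasDerivAt_const x (0:ℝ)).congr_of_eventuallyEq ?_
    filter_upwards [Ioi_mem_nhds hx'] with z hz'
    exact hz z (show x₀ ≤ z from le_of_lt (show x₀ < z from hz'))
  have := (hder x hxp).unique e
  have hx2 : x ^ 2 ≠ 0 := by positivity
  rw [div_eq_zero_iff, mul_eq_zero] at this
  rcases this with (h' | h') | h'
  · exact absurd h' (pow_ne_zero _ hd)
  · apply Complex.ext
    · simp only [Complex.zero_re]; nlinarith [sq_nonneg (y x).re, sq_nonneg (y x).im]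
    · simp only [Complex.zero_im]; nlinarith [sq_nonneg (y x).re, sq_nonneg (y x).im]
  · exact absurd h' hx2

lemma exp_PG {f : ℝ → ℂ} (hf : PG f) : Tendsto (fun x : ℝ => Complex.exp (-(x:ℂ)/2) * f x) atTop (𝓝 0) := by
  obtain ⟨N, h⟩ := hf
  have h1 : (fun x : ℝ => Complex.exp (-(x:ℂ)/2)) =O[atTop] (fun x : ℝ => Real.exp (-(1/2) * x)) := by
    apply Asymptotics.IsBigO.of_bound 1
    refine Eventually.of_forall fun x => ?_
    rw [Complex.norm_exp, Real.norm_of_nonneg (Real.exp_pos _).le, one_mul]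
    apply Real.exp_le_exp.mpr
    simp
    linarith
  have h2 := h1.mul h
  refine h2.trans_tendsto ?_
  have := tendsto_rpow_mul_exp_neg_mul_atTop_nhds_zero N (1/2) (by norm_num)
  refine this.congr fun x => ?_
  rw [Real.rpow_natCast, mul_comm]

lemma kV_ne_zero {a b : ℂ} (hai : a.im ≠ 0) (hbi : b.im ≠ 0) (hi : (a - b + 1).im ≠ 0)
    (hr : (a - b / 2).im = 0) (hd : (b ^ 2 / 4 - b / 2).im ≠ 0) {x₀ : ℝ} (hx : 0 < x₀) : kV a b x₀ ≠ 0 := by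
  intro h0
  obtain ⟨g0, g1⟩ := GG_all hai hbi hi
  have sol := KSol_V hai hbi
  set E : ℝ → ℂ := fun x => Complex.exp (-(x:ℂ)/2) * (x:ℂ) ^ (b/2) with hE
  set p : ℝ → ℂ := fun x => -1/2 + b/2 * (x:ℂ) ^ (-1:ℂ) with hp
  set y : ℝ → ℂ := fun x => E x * kV a b x with hy
  set y1 : ℝ → ℂ := fun x => E x * (p x * kV a b x + -a * kV (a+1) (b+1) x) with hy1
  set q : ℝ → ℂ := fun x => 1/4 + (a - b/2) / x + (b^2/4 - b/2) / (x:ℂ)^2 with hq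
  have dE : ∀ x : ℝ, 0 < x → HasDerivAt E (E x * p x) x := by
    intro x hx
    have hne : (x:ℂ) ≠ 0 := by exact_mod_cast hx.ne'
    have he : HasDerivAt (fun x : ℝ => Complex.exp (-(x:ℂ)/2)) (Complex.exp (-(x:ℂ)/2) * (-1/2)) x :=
      ((((hasDerivAt_id (x:ℂ)).neg).div_const 2).cexp).comp_ofReal
    have := he.mul (cpow_deriv (b/2) hx)
    convert! this using 1
    simp only [hE, hp]
    rw [show b/2 - 1 = b/2 + (-1) by ring, Complex.cpow_add _ _ hne]
    ring
  have dp : ∀ x : ℝ, 0 < x → HasDerivAt p (- b / 2 / (x:ℂ)^2) x := by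
    intro x hx
    have := ((cpow_deriv (-1) hx).const_mul (b/2)).const_add (-1/2)
    convert! this using 1
    rw [show (-1 - 1 : ℂ) = -2 by ring, Complex.cpow_neg, Complex.cpow_ofNat]
    ring
  have px : ∀ x : ℝ, p x = -1/2 + b/2/x := by
    intro x
    simp only [hp]
    rw [Complex.cpow_neg, Complex.cpow_one]
    ring
  have key := energy (y := y) (y1 := y1) (q := q) (x₀ := x₀) (d := (b^2/4 - b/2).im) hx hd ?_ ?_ ?_ ?_ ?_
    (by simp [hy, h0])
  · have hV : ∀ x : ℝ, x₀ < x → kV a b x = 0 := by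
      intro x hx'
      have hxp : 0 < x := lt_trans hx hx'
      have hne : (x:ℂ) ≠ 0 := by exact_mod_cast hxp.ne'
      have := key x hx'
      simp only [hy, hE] at this
      refine (mul_eq_zero.mp this).resolve_left (mul_ne_zero (Complex.exp_ne_zero _) ?_)
      rw [Complex.cpow_def_of_ne_zero hne]
      exact Complex.exp_ne_zero _
    have hx1 : x₀ < x₀ + 1 := by linarith
    have hxp : 0 < x₀ + 1 := by linarith
    have e0 := hV _ hx1
    have dv := KSol_lin (c := Gamma (1 - b) / Gamma (a - b + 1)) (d := Gamma (b - 1) / Gamma a)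
      (KSol_K a hbi) (KSol_S a hbi) (x₀+1) hxp
    have e1 : HasDerivAt (kV a b) 0 (x₀+1) := by
      refine (hasDerivAt_const (x₀+1) (0:ℂ)).congr_of_eventuallyEq ?_
      filter_upwards [Ioi_mem_nhds hx1] with z hz
      exact hV z hz
    have e2 := dv.1.unique e1
    have w := wr_KS a hbi hxp
    have hC : Gamma (1 - b) / Gamma (a - b + 1) ≠ 0 := by
      apply div_ne_zero
      · apply Complex.Gamma_ne_zero
        intro m hm
        have := congrArg Complex.im hm
        simp at this
        exact hbi this
      · apply Complex.Gamma_ne_zero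
        intro m hm
        apply hi
        rw [hm]; simp
    apply mul_ne_zero hC (sub_ne hbi)
    unfold wr at w
    unfold kV at e0
    set c := Gamma (1 - b) / Gamma (a - b + 1)
    set d := Gamma (b - 1) / Gamma a
    set z : ℝ := x₀ + 1
    linear_combination -c * w + ((z:ℂ) ^ b * Complex.exp (-(z:ℂ))) * (((1 - b) * kS (a+1) (b+1) z) * e0 - kS a b z * e2)
  · intro x hx
    have := (dE x hx).mul (sol x hx).1
    convert! this using 1
    simp only [hy1]
    ring
  · intro x hx
    have hne : (x:ℂ) ≠ 0 := by exact_mod_cast hx.ne'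
    have := (dE x hx).mul (((dp x hx).mul (sol x hx).1).add (sol x hx).2)
    convert! this using 1
    simp only [hy, hq, Pi.add_apply, Pi.mul_apply]
    rw [px]
    field_simp
    ring
  · intro x hx
    simp only [hq]
    have e : ((a - b/2) / (x:ℂ)).im = 0 := by rw [Complex.div_ofReal_im, hr, zero_div]
    rw [Complex.add_im, Complex.add_im, e, ← Complex.ofReal_pow, Complex.div_ofReal_im]
    norm_num
  · refine (exp_PG ((PG.cpow (b/2)).mul g0)).congr fun x => ?_
    simp only [hy, hE]; ring
  · have gp : PG p := (PG.const (-1/2)).add ((PG.const (b/2)).mul (PG.cpow (-1)))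
    refine (exp_PG ((PG.cpow (b/2)).mul ((gp.mul g0).add ((PG.const (-a)).mul g1)))).congr fun x => ?_
    simp only [hy1, hE]; ring

lemma whittakerW_eq (κ μ : ℂ) {x : ℝ} (hx : 0 < x) :
    whittakerW κ μ x = Complex.exp (-(x:ℂ)/2) * Complex.exp ((1/2 + μ) * (Real.log x : ℂ)) *
      kV (1/2 - κ + μ) (2*μ + 1) x := by
  have hne : (x:ℂ) ≠ 0 := by exact_mod_cast hx.ne'
  have hM : ∀ ν : ℂ, whittakerM κ ν x = Complex.exp (-(x:ℂ)/2) *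
      Complex.exp ((1/2 + ν) * (Real.log x : ℂ)) * kK (1/2 - κ + ν) (2*ν + 1) x := fun ν => rfl
  unfold whittakerW kV kS
  rw [hM μ, hM (-μ), Complex.cpow_def_of_ne_zero hne, ← Complex.ofReal_log hx.le]
  rw [show 1 - (2*μ + 1) = -(2*μ) by ring, show 2*μ + 1 - 1 = 2*μ by ring,
    show 1/2 - κ + μ - (2*μ+1) + 1 = 1/2 - κ - μ by ring,
    show 2 - (2*μ + 1) = 2 * (-μ) + 1 by ring, show 1/2 - κ + -μ = 1/2 - κ - μ by ring]
  have e : Complex.exp ((1/2 + -μ) * (Real.log x : ℂ)) = Complex.exp ((1/2 + μ) * (Real.log x : ℂ)) *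
      Complex.exp ((Real.log x : ℂ) * -(2*μ)) := by
    rw [← Complex.exp_add]; congr 1; ring
  rw [e]
  ring

end WhittakerAux

/-- All zeros of the entire function `μ ↦ W_{κ,μ}(x₀)` lie on the real or imaginary axis. -/
theorem stmt_14 (κ x₀ : ℝ) (hx : 0 < x₀) (F : ℂ → ℂ) (hF : Differentiable ℂ F)
    (hFW : ∀ μ : ℂ, (∀ n : ℤ, 2*μ ≠ (n:ℂ)) → F μ = whittakerW (κ:ℂ) μ x₀) :
    ∀ ρ : ℂ, F ρ = 0 → ρ.re = 0 ∨ ρ.im = 0 := by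
  intro ρ h0
  by_contra hcon
  rw [not_or] at hcon
  obtain ⟨hre, him⟩ := hcon
  have hn : ∀ n : ℤ, 2*ρ ≠ (n:ℂ) := by
    intro n h
    have := congrArg Complex.im h
    simp at this
    exact him this
  rw [hFW ρ hn, whittakerW_eq _ _ hx] at h0
  have hV := (mul_eq_zero.mp h0).resolve_left
    (mul_ne_zero (Complex.exp_ne_zero _) (Complex.exp_ne_zero _))
  refine kV_ne_zero ?_ ?_ ?_ ?_ ?_ hx hV
  · simpa using him
  · simpa using him
  · rw [show 1/2 - (κ:ℂ) + ρ - (2*ρ+1) + 1 = ((1/2 - κ : ℝ) : ℂ) - ρ by push_cast; ring]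
    rw [Complex.sub_im, Complex.ofReal_im]
    simpa using him
  · rw [show 1/2 - (κ:ℂ) + ρ - (2*ρ+1)/2 = ((-κ : ℝ) : ℂ) by push_cast; ring]
    exact Complex.ofReal_im _
  · rw [show (2*ρ+1)^2/4 - (2*ρ+1)/2 = ρ * ρ - ((1/4 : ℝ) : ℂ) by push_cast; ring]
    rw [Complex.sub_im, Complex.ofReal_im, Complex.mul_im]
    intro h
    have h3 : ρ.re * ρ.im = 0 := by linarith
    exact (mul_ne_zero hre him) h3
end
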